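/- arXiv:1811.06718 — 3 statements merged into one kernel-verified Lean document; each statement's English description precedes it below -/
import Mathlib

section
/- Let T be an ABC-tile having exactly 14 neighbors. Then for any two distinct α, β ∈ ℤ³ \ {0}, the 3-fold intersection T ∩ (T + α) ∩ (T + β) is either empty or homeomorphic to the closed interval [0,1]. Moreover, there are exactly 36 two-element subsets {α, β} of ℤ³ \ {0} for which T ∩ (T + α) ∩ (T + β) is nonempty. -/
open MeasureTheory

noncomputable def Mmat (A B C : ℤ) : Matrix (Fin 3) (Fin 3) ℝ :=
  !![0, 0, -(C : ℝ); 1, 0, -(B : ℝ); 0, 1, -(A : ℝ)]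

def Ddig (C : ℤ) : Set (Fin 3 → ℝ) :=
  {d | ∃ i : ℤ, 0 ≤ i ∧ i < C ∧ d = ![(i : ℝ), 0, 0]}

def toR (α : Fin 3 → ℤ) : Fin 3 → ℝ := fun i => (α i : ℝ)

def tileTranslate (v : Fin 3 → ℝ) (T : Set (Fin 3 → ℝ)) : Set (Fin 3 → ℝ) :=
  (fun x => x + v) '' T

def IsABCTile (A B C : ℤ) (T : Set (Fin 3 → ℝ)) : Prop :=
  1 ≤ A ∧ A ≤ B ∧ B < C ∧
  T.Nonempty ∧ IsCompact T ∧ 0 < volume T ∧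
  (Mmat A B C).mulVec '' T = ⋃ d ∈ Ddig C, tileTranslate d T

def Neighbors (T : Set (Fin 3 → ℝ)) : Set (Fin 3 → ℤ) :=
  {α | α ≠ 0 ∧ (T ∩ tileTranslate (toR α) T).Nonempty}

/-- Two points lie in a common cylinder of level `m`. -/
def SameCyl {V X : Type*} (n : V → ℕ) (ch : V → ℕ → V) (K : V → Set X) (F : V → ℕ → X → X) :
    ℕ → V → X → X → Prop
  | 0, v, x, y => x ∈ K v ∧ y ∈ K v
  | m + 1, v, x, y => ∃ i, i < n v ∧ ∃ x' y', F v i x' = x ∧ F v i y' = y ∧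
      SameCyl n ch K F m (ch v i) x' y'

/-- A graph-directed system of sets which subdivide into chains. -/
structure ChainSys {V X : Type*} [TopologicalSpace X] (good : V → Prop) (n : V → ℕ)
    (ch : V → ℕ → V) (K : V → Set X) (F : V → ℕ → X → X) (p q : V → X) : Prop where
  npos : ∀ v, good v → 0 < n v
  gch : ∀ v i, good v → i < n v → good (ch v i)
  cpt : ∀ v, good v → IsCompact (K v)
  pmem : ∀ v, good v → p v ∈ K v
  qmem : ∀ v, good v → q v ∈ K v
  Fcont : ∀ v i, Continuous (F v i)
  Finj : ∀ v i, good v → Function.Injective (F v i)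
  cover : ∀ v x, good v → (x ∈ K v ↔ ∃ i, i < n v ∧ ∃ x' ∈ K (ch v i), F v i x' = x)
  pfirst : ∀ v, good v → F v 0 (p (ch v 0)) = p v
  qlast : ∀ v, good v → F v (n v - 1) (q (ch v (n v - 1))) = q v
  glue : ∀ v i, good v → i + 1 < n v → F v i (q (ch v i)) = F v (i + 1) (p (ch v (i + 1)))
  overlap : ∀ v i j x y, good v → i < j → j < n v → x ∈ K (ch v i) → y ∈ K (ch v j) →
    F v i x = F v j y → j = i + 1 ∧ x = q (ch v i) ∧ y = p (ch v j)
  ne : ∀ v, good v → p v ≠ q v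
  mesh : ∀ v x y, good v → (∀ m, SameCyl n ch K F m v x y) → x = y

/-- approximations of the graph of the homeomorphism -/
def GG {V X Y : Type*} (n : V → ℕ) (ch : V → ℕ → V) (K : V → Set X) (F : V → ℕ → X → X)
    (K' : V → Set Y) (F' : V → ℕ → Y → Y) : ℕ → V → Set (X × Y)
  | 0, v => K v ×ˢ K' v
  | m + 1, v => ⋃ i ∈ Finset.range (n v), Prod.map (F v i) (F' v i) '' GG n ch K F K' F' m (ch v i)

section chain
set_option linter.unusedSectionVars false
variable {V X Y : Type*} [TopologicalSpace X] [TopologicalSpace Y] [T2Space X] [T2Space Y]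
  {good : V → Prop} {n : V → ℕ} {ch : V → ℕ → V}
  {K : V → Set X} {F : V → ℕ → X → X} {p q : V → X}
  {K' : V → Set Y} {F' : V → ℕ → Y → Y} {p' q' : V → Y}

theorem GG_succ {m : ℕ} {v : V} {x : X} {y : Y} : (x, y) ∈ GG n ch K F K' F' (m+1) v ↔
    ∃ i, i < n v ∧ ∃ x' y', (x', y') ∈ GG n ch K F K' F' m (ch v i) ∧ F v i x' = x ∧
      F' v i y' = y := by
  simp only [GG, Set.mem_iUnion, Finset.mem_range, Set.mem_image, Prod.exists, Prod.map_apply,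
    Prod.mk.injEq, exists_prop]

theorem GG_swap (m : ℕ) (v : V) (x : X) (y : Y) :
    (x, y) ∈ GG n ch K F K' F' m v ↔ (y, x) ∈ GG n ch K' F' K F m v := by
  induction m generalizing v x y with
  | zero => simp [GG, and_comm]
  | succ m ih =>
    rw [GG_succ, GG_succ]
    constructor
    · rintro ⟨i, hi, x', y', h, h1, h2⟩
      exact ⟨i, hi, y', x', (ih _ _ _).1 h, h2, h1⟩
    · rintro ⟨i, hi, x', y', h, h1, h2⟩
      exact ⟨i, hi, y', x', (ih _ _ _).2 h, h2, h1⟩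

theorem GG_compact (h1 : ChainSys good n ch K F p q) (h2 : ChainSys good n ch K' F' p' q')
    (m : ℕ) (v : V) (hv : good v) : IsCompact (GG n ch K F K' F' m v) := by
  induction m generalizing v with
  | zero => exact (h1.cpt v hv).prod (h2.cpt v hv)
  | succ m ih =>
    refine Finset.isCompact_biUnion _ fun i hi => ?_
    exact (ih _ (h1.gch v i hv (Finset.mem_range.1 hi))).image
      ((h1.Fcont v i).prodMap (h2.Fcont v i))

theorem GG_anti (h1 : ChainSys good n ch K F p q) (h2 : ChainSys good n ch K' F' p' q')
    (m : ℕ) (v : V) (hv : good v) : GG n ch K F K' F' (m+1) v ⊆ GG n ch K F K' F' m v := by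
  induction m generalizing v with
  | zero =>
    rintro ⟨x, y⟩ h
    obtain ⟨i, hi, x', y', hh, rfl, rfl⟩ := GG_succ.1 h
    exact ⟨(h1.cover v _ hv).2 ⟨i, hi, x', hh.1, rfl⟩, (h2.cover v _ hv).2 ⟨i, hi, y', hh.2, rfl⟩⟩
  | succ m ih =>
    rintro ⟨x, y⟩ h
    obtain ⟨i, hi, x', y', hh, rfl, rfl⟩ := GG_succ.1 h
    exact GG_succ.2 ⟨i, hi, x', y', ih _ (h1.gch v i hv hi) hh, rfl, rfl⟩

theorem GG_antitone (h1 : ChainSys good n ch K F p q) (h2 : ChainSys good n ch K' F' p' q')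
    (v : V) (hv : good v) : Antitone (fun m => GG n ch K F K' F' m v) :=
  antitone_nat_of_succ_le fun m => GG_anti h1 h2 m v hv

theorem GG_total (h1 : ChainSys good n ch K F p q) (h2 : ChainSys good n ch K' F' p' q')
    (v : V) (hv : good v) (x : X) (hx : x ∈ K v) : ∃ y, ∀ m, (x, y) ∈ GG n ch K F K' F' m v := by
  have key : ∀ m v, good v → ∀ x ∈ K v, ∃ y, (x, y) ∈ GG n ch K F K' F' m v := by
    intro m
    induction m with
    | zero => intro v hv x hx; exact ⟨p' v, hx, h2.pmem v hv⟩
    | succ m ih =>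
      intro v hv x hx
      obtain ⟨i, hi, x', hx', rfl⟩ := (h1.cover v x hv).1 hx
      obtain ⟨y, hy⟩ := ih _ (h1.gch v i hv hi) x' hx'
      exact ⟨_, GG_succ.2 ⟨i, hi, x', y, hy, rfl, rfl⟩⟩
  have hc : ∀ m, IsCompact ({z : X × Y | z.1 = x} ∩ GG n ch K F K' F' m v) := fun m =>
    (GG_compact h1 h2 m v hv).inter_left (isClosed_singleton.preimage continuous_fst)
  obtain ⟨⟨a, b⟩, hz⟩ := IsCompact.nonempty_iInter_of_sequence_nonempty_isCompact_isClosed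
    (fun m => {z : X × Y | z.1 = x} ∩ GG n ch K F K' F' m v)
    (fun m => Set.inter_subset_inter_right _ (GG_anti h1 h2 m v hv))
    (fun m => by
      obtain ⟨y, hy⟩ := key m v hv x hx
      exact ⟨(x, y), rfl, hy⟩) (hc 0) (fun m => (hc m).isClosed)
  rw [Set.mem_iInter] at hz
  have : a = x := (hz 0).1
  subst this
  exact ⟨b, fun m => (hz m).2⟩

theorem GG_unfold (h1 : ChainSys good n ch K F p q) (h2 : ChainSys good n ch K' F' p' q')
    (v : V) (hv : good v) (x : X) (y : Y) (h : ∀ m, (x, y) ∈ GG n ch K F K' F' m v) :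
    ∃ i, i < n v ∧ ∃ x' y', (∀ m, (x', y') ∈ GG n ch K F K' F' m (ch v i)) ∧ F v i x' = x ∧
      F' v i y' = y := by
  by_contra hcon
  push Not at hcon
  have hbad : ∀ i, i < n v → ∃ m, ∀ x' y', F v i x' = x → F' v i y' = y →
      (x', y') ∉ GG n ch K F K' F' m (ch v i) := by
    intro i hi
    by_cases hex : ∃ x' y', F v i x' = x ∧ F' v i y' = y
    · obtain ⟨x', y', hx', hy'⟩ := hex
      have : ∃ m, (x', y') ∉ GG n ch K F K' F' m (ch v i) := by
        by_contra hh
        push Not at hh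
        exact hcon i hi x' y' hh hx' hy'
      obtain ⟨m, hm⟩ := this
      refine ⟨m, fun x'' y'' e1 e2 => ?_⟩
      rw [h1.Finj v i hv (e1.trans hx'.symm), h2.Finj v i hv (e2.trans hy'.symm)]
      exact hm
    · exact ⟨0, fun x' y' e1 e2 => (hex ⟨x', y', e1, e2⟩).elim⟩
  choose! f hf using hbad
  obtain ⟨i, hi, x', y', hm, e1, e2⟩ := GG_succ.1 (h ((Finset.range (n v)).sup f + 1))
  exact hf i hi x' y' e1 e2 (GG_antitone h1 h2 _ (h1.gch v i hv hi)
    (Finset.le_sup (Finset.mem_range.2 hi)) hm)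

theorem GG_q (h1 : ChainSys good n ch K F p q) (h2 : ChainSys good n ch K' F' p' q')
    (v : V) (hv : good v) (y : Y) (h : ∀ m, (q v, y) ∈ GG n ch K F K' F' m v) : y = q' v := by
  refine h2.mesh v _ _ hv fun m => ?_
  induction m generalizing v y with
  | zero => exact ⟨(h 0).2, h2.qmem v hv⟩
  | succ m ih =>
    obtain ⟨i, hi, x', y', hm, e1, e2⟩ := GG_unfold h1 h2 v hv _ _ h
    have hl : n v - 1 < n v := Nat.sub_lt (h1.npos v hv) one_pos
    have hil : i = n v - 1 := by
      by_contra hne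
      have hlt : i < n v - 1 := by omega
      have hg := h1.gch v (n v - 1) hv hl
      have := h1.overlap v i (n v - 1) x' (q (ch v (n v - 1))) hv hlt hl (hm 0).1
        (h1.qmem _ hg) (e1.trans (h1.qlast v hv).symm)
      exact h1.ne _ hg this.2.2.symm
    subst hil
    have hx' : x' = q (ch v (n v - 1)) := h1.Finj v _ hv (e1.trans (h1.qlast v hv).symm)
    subst hx'
    exact ⟨_, hl, y', q' (ch v (n v - 1)), e2, h2.qlast v hv, ih _ (h1.gch v _ hv hl) y' hm⟩

theorem GG_p (h1 : ChainSys good n ch K F p q) (h2 : ChainSys good n ch K' F' p' q')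
    (v : V) (hv : good v) (y : Y) (h : ∀ m, (p v, y) ∈ GG n ch K F K' F' m v) : y = p' v := by
  refine h2.mesh v _ _ hv fun m => ?_
  induction m generalizing v y with
  | zero => exact ⟨(h 0).2, h2.pmem v hv⟩
  | succ m ih =>
    obtain ⟨i, hi, x', y', hm, e1, e2⟩ := GG_unfold h1 h2 v hv _ _ h
    have hl : 0 < n v := h1.npos v hv
    have hil : i = 0 := by
      by_contra hne
      have hlt : 0 < i := by omega
      have hg := h1.gch v 0 hv hl
      have := h1.overlap v 0 i (p (ch v 0)) x' hv hlt hi (h1.pmem _ hg) (hm 0).1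
        ((h1.pfirst v hv).trans e1.symm)
      exact h1.ne _ hg this.2.1
    subst hil
    have hx' : x' = p (ch v 0) := h1.Finj v _ hv (e1.trans (h1.pfirst v hv).symm)
    subst hx'
    exact ⟨_, hl, y', p' (ch v 0), e2, h2.pfirst v hv, ih _ (h1.gch v _ hv hl) y' hm⟩

theorem GG_fun (h1 : ChainSys good n ch K F p q) (h2 : ChainSys good n ch K' F' p' q')
    (v : V) (hv : good v) (x : X) (y y₁ : Y) (h : ∀ m, (x, y) ∈ GG n ch K F K' F' m v)
    (h' : ∀ m, (x, y₁) ∈ GG n ch K F K' F' m v) : y = y₁ := by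
  by_contra hne
  refine hne (h2.mesh v _ _ hv fun m => ?_)
  induction m generalizing v x y y₁ with
  | zero => exact ⟨(h 0).2, (h' 0).2⟩
  | succ m ih =>
    have main : ∀ i j x' y' x₁ y₁', i < j → j < n v →
        (∀ m, (x', y') ∈ GG n ch K F K' F' m (ch v i)) →
        (∀ m, (x₁, y₁') ∈ GG n ch K F K' F' m (ch v j)) → F v i x' = F v j x₁ →
        F' v i y' = F' v j y₁' := by
      intro i j x' y' x₁ y₁' hij hj hm hm1 e
      obtain ⟨rfl, hx, hx1⟩ := h1.overlap v i j x' x₁ hv hij hj (hm 0).1 (hm1 0).1 e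
      subst hx hx1
      rw [GG_q h1 h2 _ (h1.gch v i hv (by omega)) _ hm, GG_p h1 h2 _ (h1.gch v _ hv hj) _ hm1]
      exact h2.glue v i hv hj
    obtain ⟨i, hi, x', y', hm, e1, e2⟩ := GG_unfold h1 h2 v hv _ _ h
    obtain ⟨j, hj, x₁, y₁', hm1, e3, e4⟩ := GG_unfold h1 h2 v hv _ _ h'
    rcases lt_trichotomy i j with hij | hij | hij
    · exact (hne (by rw [← e2, ← e4]; exact main i j _ _ _ _ hij hj hm hm1 (e1.trans e3.symm))).elim
    · subst hij
      have : x' = x₁ := h1.Finj v i hv (e1.trans e3.symm)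
      subst this
      exact ⟨i, hi, y', y₁', e2, e4, ih _ (h1.gch v i hv hi) x' y' y₁' hm hm1
        (fun hh => hne (by rw [← e2, ← e4, hh]))⟩
    · exact (hne (by rw [← e2, ← e4]; exact (main j i _ _ _ _ hij hi hm1 hm (e3.trans e1.symm)).symm)).elim

theorem chain_homeo_aux (h1 : ChainSys good n ch K F p q) (h2 : ChainSys good n ch K' F' p' q')
    (v : V) (hv : good v) :
    Nonempty ((⋂ m, GG n ch K F K' F' m v : Set (X × Y)) ≃ₜ K v) := by
  have hc : IsCompact (⋂ m, GG n ch K F K' F' m v) :=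
    (GG_compact h1 h2 0 v hv).of_isClosed_subset
      (isClosed_iInter fun m => (GG_compact h1 h2 m v hv).isClosed) (Set.iInter_subset _ 0)
  have : CompactSpace (⋂ m, GG n ch K F K' F' m v : Set (X × Y)) :=
    isCompact_iff_compactSpace.1 hc
  let f : (⋂ m, GG n ch K F K' F' m v : Set (X × Y)) → K v :=
    fun z => ⟨z.1.1, (Set.mem_iInter.1 z.2 0).1⟩
  have hf : Continuous f :=
    Continuous.subtype_mk (continuous_fst.comp continuous_subtype_val) _
  have hb : Function.Bijective f := by
    constructor
    · rintro ⟨⟨x, y⟩, hz⟩ ⟨⟨x1, y1⟩, hz1⟩ h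
      have hx : x = x1 := congrArg Subtype.val h
      subst hx
      have := GG_fun h1 h2 v hv x y y1 (Set.mem_iInter.1 hz) (Set.mem_iInter.1 hz1)
      subst this
      rfl
    · rintro ⟨x, hx⟩
      obtain ⟨y, hy⟩ := GG_total h1 h2 v hv x hx
      exact ⟨⟨(x, y), Set.mem_iInter.2 hy⟩, rfl⟩
  exact ⟨Continuous.homeoOfEquivCompactToT2 (f := Equiv.ofBijective f hb) hf⟩

theorem chain_homeo (h1 : ChainSys good n ch K F p q) (h2 : ChainSys good n ch K' F' p' q')
    (v : V) (hv : good v) : Nonempty (K v ≃ₜ K' v) := by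
  obtain ⟨e1⟩ := chain_homeo_aux h1 h2 v hv
  obtain ⟨e2⟩ := chain_homeo_aux h2 h1 v hv
  have hs : (⋂ m, GG n ch K F K' F' m v : Set (X × Y)) =
      Homeomorph.prodComm X Y ⁻¹' (⋂ m, GG n ch K' F' K F m v) := by
    ext ⟨x, y⟩
    rw [Set.mem_preimage, Set.mem_iInter, Set.mem_iInter]
    exact forall_congr' fun m => GG_swap m v x y
  have e3 : (⋂ m, GG n ch K F K' F' m v : Set (X × Y)) ≃ₜ
      (⋂ m, GG n ch K' F' K F m v : Set (Y × X)) :=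
    (Homeomorph.setCongr hs).trans
      ((Homeomorph.prodComm X Y).sets rfl)
  exact ⟨e1.symm.trans (e3.trans e2)⟩

end chain

/-- The interval as a chain system. -/
theorem interval_chain {V : Type*} {good : V → Prop} {n : V → ℕ} {ch : V → ℕ → V} (r : V → ℕ)
    (hn : ∀ v, good v → 0 < n v) (hg : ∀ v i, good v → i < n v → good (ch v i))
    (hr3 : ∀ v, r v ≤ 3) (hr : ∀ v, good v → n v = 1 → r (ch v 0) < r v) :
    ChainSys good n ch (fun _ => Set.Icc (0:ℝ) 1) (fun v i t => ((i:ℝ) + t) / n v)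
      (fun _ => 0) (fun _ => 1) where
  npos := hn
  gch := hg
  cpt := fun _ _ => isCompact_Icc
  pmem := fun _ _ => by simp
  qmem := fun _ _ => by simp
  Fcont := fun v i => by fun_prop
  Finj := fun v i hv x y h => by
    have : (0:ℝ) < n v := by exact_mod_cast hn v hv
    simp only at h
    field_simp at h
    linarith
  cover := fun v x hv => by
    have h0 : (0:ℝ) < n v := by exact_mod_cast hn v hv
    constructor
    · rintro ⟨hx0, hx1⟩
      by_cases h : x = 1
      · subst h
        refine ⟨n v - 1, Nat.sub_lt (hn v hv) one_pos, 1, by simp, ?_⟩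
        rw [Nat.cast_sub (show 1 ≤ n v from hn v hv)]
        field_simp
        simp
      · have hlt : x < 1 := lt_of_le_of_ne hx1 h
        have hnn : 0 ≤ (n v : ℝ) * x := by positivity
        refine ⟨⌊(n v : ℝ) * x⌋₊, ?_, (n v : ℝ) * x - ⌊(n v : ℝ) * x⌋₊, ⟨?_, ?_⟩, ?_⟩
        · rw [Nat.floor_lt hnn]
          nlinarith
        · linarith [Nat.floor_le hnn]
        · linarith [Nat.lt_floor_add_one ((n v : ℝ) * x)]
        · field_simp
          ring
    · rintro ⟨i, hi, t, ⟨ht0, ht1⟩, rfl⟩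
      have : (i : ℝ) + 1 ≤ n v := by exact_mod_cast hi
      constructor
      · positivity
      · rw [div_le_one h0]; linarith
  pfirst := fun v hv => by simp
  qlast := fun v hv => by
    have h0 : (0:ℝ) < n v := by exact_mod_cast hn v hv
    rw [Nat.cast_sub (show 1 ≤ n v from hn v hv)]
    field_simp
    simp
  glue := fun v i hv hi => by push_cast; simp
  overlap := fun v i j x y hv hij hj hx hy h => by
    have h0 : (0:ℝ) < n v := by exact_mod_cast hn v hv
    field_simp at h
    have h1 : (i : ℝ) + 1 ≤ j := by exact_mod_cast hij
    have hx1 := hx.2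
    have hy0 := hy.1
    refine ⟨?_, by linarith, by linarith⟩
    have : (j : ℝ) = i + 1 := by linarith
    exact_mod_cast this
  ne := fun _ _ => by simp
  mesh := fun v x y hv h => by
    have key : ∀ m v x y, good v → SameCyl n ch (fun _ => Set.Icc (0:ℝ) 1)
        (fun v i t => ((i:ℝ) + t) / n v) m v x y →
        |x - y| ≤ (9/10:ℝ)^m * (10/9:ℝ)^(r v) := by
      intro m
      induction m with
      | zero =>
        rintro v x y hv ⟨⟨h1, h2⟩, ⟨h3, h4⟩⟩
        have : (1:ℝ) ≤ (10/9:ℝ)^(r v) := one_le_pow₀ (by norm_num)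
        rw [pow_zero, one_mul, abs_le]
        constructor <;> linarith
      | succ m ih =>
        rintro v x y hv ⟨i, hi, x', y', rfl, rfl, hs⟩
        have h0 : (0:ℝ) < n v := by exact_mod_cast hn v hv
        have := ih _ _ _ (hg v i hv hi) hs
        have e : |(i + x') / (n v : ℝ) - (i + y') / n v| = |x' - y'| / n v := by
          rw [← abs_of_pos h0, ← abs_div, abs_of_pos h0]; congr 1; ring
        rw [e, div_le_iff₀ h0]
        refine this.trans ?_
        rw [pow_succ (9/10:ℝ) m, mul_assoc, mul_assoc]
        refine mul_le_mul_of_nonneg_left ?_ (by positivity)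
        by_cases h1 : n v = 1
        · have hi0 : i = 0 := by omega
          subst hi0
          have hlt := hr v hv h1
          rw [h1]
          obtain ⟨d, hd⟩ := Nat.exists_eq_add_of_lt hlt
          rw [hd, pow_succ, pow_add]
          have : (1:ℝ) ≤ (10/9:ℝ)^d := one_le_pow₀ (by norm_num)
          have h5 : (0:ℝ) < (10/9:ℝ)^(r (ch v 0)) := by positivity
          norm_num
          nlinarith
        · have h2 : (2:ℝ) ≤ n v := by
            have : 2 ≤ n v := by have := hn v hv; omega
            exact_mod_cast this
          have h3 : (10/9:ℝ)^(r (ch v i)) ≤ (10/9:ℝ)^3 :=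
            pow_le_pow_right₀ (by norm_num) (hr3 _)
          have h4 : (1:ℝ) ≤ (10/9:ℝ)^(r v) := one_le_pow₀ (by norm_num)
          norm_num at h3
          nlinarith
    have ht : Filter.Tendsto (fun m : ℕ => (9/10:ℝ)^m * (10/9:ℝ)^(r v)) Filter.atTop (nhds 0) := by
      have := (tendsto_pow_atTop_nhds_zero_of_lt_one (r := (9/10:ℝ)) (by norm_num)
        (by norm_num)).mul_const ((10/9:ℝ)^(r v))
      simpa using this
    have := ge_of_tendsto' ht (fun m => key m v x y hv (h m))
    have := abs_nonpos_iff.1 this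
    linarith

theorem avg_upper {C a b c x0 x1 x2 x3 x4 u t : ℝ} (ha : 0 ≤ a) (hb : 0 ≤ b) (hc : 1 ≤ c)
    (hC : 1 + a + b + c = C) (h : C * x0 = x4 + a * x3 + b * x2 + c * x1)
    (h4 : x4 ≤ u) (h3 : x3 ≤ u) (h2 : x2 ≤ u) (h1 : x1 ≤ u - t) (ht : 0 ≤ t) :
    x0 ≤ u - t / C := by
  have hCp : 0 < C := by linarith
  have : C * x0 ≤ C * (u - t / C) := by
    rw [mul_sub, mul_div_cancel₀ _ hCp.ne', h]
    have e : C * u = u + a * u + b * u + c * u := by rw [← hC]; ring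
    have e1 := mul_le_mul_of_nonneg_left h1 (by linarith : 0 ≤ c)
    have e2 := mul_le_mul_of_nonneg_right hc ht
    linarith [mul_le_mul_of_nonneg_left h3 ha, mul_le_mul_of_nonneg_left h2 hb]
  exact le_of_mul_le_mul_left this hCp

/-- window step, upper version -/
theorem window_upper {C a b c : ℝ} (ha : 0 ≤ a) (hb : 0 ≤ b) (hc : 1 ≤ c)
    (hC : 1 + a + b + c = C) (z : ℕ → ℝ)
    (hz : ∀ m, C * z m = z (m+4) + a * z (m+3) + b * z (m+2) + c * z (m+1))
    (m : ℕ) (u t : ℝ) (ht : 0 ≤ t) (hu : ∀ i < 4, z (m + 4 + i) ≤ u) (h4 : z (m+4) ≤ u - t) :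
    ∀ i < 4, z (m + i) ≤ u - t / C ^ 4 := by
  have hC1 : 1 ≤ C := by linarith
  have hCp : 0 < C := by linarith
  have mono : ∀ s : ℝ, 0 ≤ s → s / C ≤ s := fun s hs => div_le_self hs hC1
  have n1 : 0 ≤ t / C := by positivity
  have n2 : 0 ≤ t / C / C := by positivity
  have n3 : 0 ≤ t / C / C / C := by positivity
  have u4 := hu 0 (by norm_num)
  have u5 := hu 1 (by norm_num)
  have u6 := hu 2 (by norm_num)
  have u7 := hu 3 (by norm_num)
  have s3 := avg_upper ha hb hc hC (hz (m+3)) u7 u6 u5 h4 ht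
  have s2 := avg_upper ha hb hc hC (hz (m+2)) u6 u5 (by simpa using u4) s3 n1
  have s1 := avg_upper ha hb hc hC (hz (m+1)) u5 (by simpa using u4) (by linarith : z (m+3) ≤ u) s2 n2
  have s0 := avg_upper ha hb hc hC (hz m) (by simpa using u4) (by linarith : z (m+3) ≤ u)
    (by linarith : z (m+2) ≤ u) s1 n3
  have e : t / C ^ 4 = t / C / C / C / C := by field_simp
  have m1 := mono _ n1
  have m2 := mono _ n2
  have m3 := mono _ n3
  intro i hi
  rw [e]
  interval_cases i
  · simpa using s0
  · linarith
  · linarith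
  · linarith

theorem bounded_const {C a b c : ℝ} (ha : 0 ≤ a) (hb : 0 ≤ b) (hc : 1 ≤ c)
    (hC : 1 + a + b + c = C) (z : ℕ → ℝ)
    (hz : ∀ m, C * z m = z (m+4) + a * z (m+3) + b * z (m+2) + c * z (m+1))
    (D : ℝ) (hD : ∀ m, |z m| ≤ D) : z 0 = z 1 := by
  have hC1 : 1 ≤ C := by linarith
  have hCp : 0 < C := by linarith
  set ρ : ℝ := 1 - 1 / 2 / C ^ 4 with hρ
  have hq : 1 / 2 / C ^ 4 ≤ 1 / 2 := div_le_self (by norm_num) (one_le_pow₀ hC1)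
  have hq0 : 0 < 1 / 2 / C ^ 4 := by positivity
  have hD0 : 0 ≤ D := (abs_nonneg _).trans (hD 0)
  have key : ∀ j m : ℕ, ∃ l : ℝ, ∀ i < 4, l ≤ z (m + i) ∧ z (m + i) ≤ l + ρ ^ j * (2 * D) := by
    intro j
    induction j with
    | zero =>
      intro m
      refine ⟨-D, fun i _ => ?_⟩
      have := abs_le.1 (hD (m + i))
      constructor <;> linarith
    | succ j ih =>
      intro m
      obtain ⟨l, hl⟩ := ih (m + 4)
      set δ := ρ ^ j * (2 * D) with hδ
      have hδ0 : 0 ≤ δ := by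
        have : 0 ≤ ρ := by linarith
        positivity
      have e : ρ ^ (j+1) * (2 * D) = δ - δ / 2 / C ^ 4 := by
        rw [pow_succ, hδ, hρ]; field_simp
      rw [e]
      have hzn : ∀ m, C * (-z m) = (-z (m+4)) + a * (-z (m+3)) + b * (-z (m+2)) + c * (-z (m+1)) :=
        fun m => by linarith [hz m]
      by_cases hmid : z (m + 4) ≤ l + δ / 2
      · have up := window_upper ha hb hc hC z hz m (l + δ) (δ / 2) (by linarith)
          (fun i hi => (hl i hi).2) (by linarith)
        have lo := window_upper ha hb hc hC (fun m => - z m) hzn m (-l) 0 le_rfl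
          (fun i hi => by linarith [(hl i hi).1]) (by linarith [(hl 0 (by norm_num)).1])
        refine ⟨l, fun i hi => ⟨?_, ?_⟩⟩
        · have := lo i hi
          simp at this
          exact this
        · linarith [up i hi]
      · have up := window_upper ha hb hc hC z hz m (l + δ) 0 le_rfl
          (fun i hi => (hl i hi).2) (by linarith [(hl 0 (by norm_num)).2])
        have lo := window_upper ha hb hc hC (fun m => - z m) hzn m (-l) (δ / 2) (by linarith)
          (fun i hi => by linarith [(hl i hi).1]) (by linarith)
        refine ⟨l + δ / 2 / C ^ 4, fun i hi => ⟨?_, ?_⟩⟩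
        · linarith [lo i hi]
        · have := up i hi
          simp at this
          linarith
  have ht : Filter.Tendsto (fun j : ℕ => ρ ^ j * (2 * D)) Filter.atTop (nhds 0) := by
    have := (tendsto_pow_atTop_nhds_zero_of_lt_one (r := ρ) (by linarith)
      (by linarith)).mul_const (2 * D)
    simpa using this
  have hle := ge_of_tendsto' ht (b := |z 0 - z 1|) (fun j => by
    obtain ⟨l, hl⟩ := key j 0
    have h0 := hl 0 (by norm_num)
    have h1 := hl 1 (by norm_num)
    simp only [zero_add] at h0 h1
    rw [abs_le]
    constructor <;> linarith)
  have := abs_nonpos_iff.1 hle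
  linarith

/-- The matrix `M` as an explicit function. -/
def Mf (A B C : ℤ) (v : Fin 3 → ℝ) : Fin 3 → ℝ :=
  ![-(C:ℝ) * v 2, v 0 - B * v 2, v 1 - A * v 2]

/-- The inverse of the matrix. -/
noncomputable def Nf (A B C : ℤ) (v : Fin 3 → ℝ) : Fin 3 → ℝ :=
  ![v 1 - B * (v 0 / C), v 2 - A * (v 0 / C), -(v 0 / C)]

theorem Mf_Nf {A B C : ℤ} (hC : (C:ℝ) ≠ 0) (v : Fin 3 → ℝ) : Mf A B C (Nf A B C v) = v := by
  funext i; fin_cases i <;> simp [Mf, Nf]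
  field_simp

theorem Nf_Mf {A B C : ℤ} (hC : (C:ℝ) ≠ 0) (v : Fin 3 → ℝ) : Nf A B C (Mf A B C v) = v := by
  funext i; fin_cases i <;> simp [Mf, Nf] <;> field_simp <;> ring

theorem Nf_cont (A B C : ℤ) : Continuous (Nf A B C) := by
  unfold Nf
  refine continuous_pi fun i => ?_
  fin_cases i <;> simp <;> fun_prop

theorem Mf_sub (A B C : ℤ) (v w : Fin 3 → ℝ) : Mf A B C (v - w) = Mf A B C v - Mf A B C w := by
  funext i; fin_cases i <;> simp [Mf] <;> ring

theorem Mf_iter_sub (A B C : ℤ) (n : ℕ) (v w : Fin 3 → ℝ) :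
    (Mf A B C)^[n] (v - w) = (Mf A B C)^[n] v - (Mf A B C)^[n] w := by
  induction n generalizing v w with
  | zero => rfl
  | succ n ih => simp only [Function.iterate_succ_apply, Mf_sub, ih]

theorem Mf_eq (A B C : ℤ) (v : Fin 3 → ℝ) : (Mmat A B C).mulVec v = Mf A B C v := by
  funext i; fin_cases i <;>
    simp [Mmat, Mf, Matrix.mulVec, dotProduct, Fin.sum_univ_three] <;> ring

theorem Mf_bounded {A B C : ℤ} (hA : 1 ≤ A) (hB : A ≤ B) (hC : B < C) (d : Fin 3 → ℝ) (D : ℝ)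
    (hD : ∀ n i, |(Mf A B C)^[n] d i| ≤ D) : d = 0 := by
  have hA' : (1:ℝ) ≤ A := by exact_mod_cast hA
  have hB' : (A:ℝ) ≤ B := by exact_mod_cast hB
  have hC' : (B:ℝ) + 1 ≤ C := by exact_mod_cast hC
  have hM : Mf A B C d = d := by
    funext i
    refine (bounded_const (C := C) (a := A - 1) (b := B - A) (c := C - B) (by linarith)
      (by linarith) (by linarith) (by ring) (fun n => (Mf A B C)^[n] d i) ?_ D
      (fun n => hD n i)).symm
    intro m
    simp only [Function.iterate_succ_apply']
    generalize (Mf A B C)^[m] d = v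
    fin_cases i <;> simp [Mf] <;> ring
  have h0 := congrFun hM 0
  have h1 := congrFun hM 1
  have h2 := congrFun hM 2
  simp [Mf] at h0 h1 h2
  have h20 : (1 + A + B + C : ℝ) * d 2 = 0 := by linarith
  have h2' : d 2 = 0 := by
    rcases mul_eq_zero.1 h20 with h | h
    · linarith
    · exact h
  rw [h2'] at h0 h1 h2
  funext i
  fin_cases i <;> simp <;> linarith

/-- Lattice points are described by heights, modulo constants. -/
abbrev Ht := Fin 4 → ℤ

/-- generator -/
def dl (x : Fin 4) : Ht := fun j => if j = x then 1 else 0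

/-- translation in the digit direction -/
def up (h : Ht) (i : ℤ) : Ht := fun j => h j + if j = 0 then i else 0

theorem up_add_dl (h : Ht) (i : ℤ) (x : Fin 4) : up h i + dl x = up (h + dl x) i := by
  funext j; simp only [up, Pi.add_apply]; ring

theorem up_up (h : Ht) (i i' : ℤ) : up (up h i) i' = up h (i + i') := by
  funext j; simp only [up]; split_ifs <;> ring

theorem add_dl_zero (h : Ht) : h + dl 0 = up h 1 := by
  funext j; simp [up, dl]

/-- all distinct -/
def Nd (x y z w : Fin 4) : Prop := x ≠ y ∧ x ≠ z ∧ x ≠ w ∧ y ≠ z ∧ y ≠ w ∧ z ≠ w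

instance (x y z w : Fin 4) : Decidable (Nd x y z w) := by unfold Nd; infer_instance

theorem Nd_shift : ∀ x y z w, Nd x y z w → Nd (x+1) (y+1) (z+1) (w+1) := by decide

theorem Nd_swap {x y z w : Fin 4} (h : Nd x y z w) : Nd y x z w := by
  obtain ⟨a, b, c, d, e, f⟩ := h
  exact ⟨a.symm, d, e, b, c, f⟩

theorem Nd_cover : ∀ x y z w, Nd x y z w → ∀ j, j = x ∨ j = y ∨ j = z ∨ j = w := by decide

theorem Nd_sum {x y z w : Fin 4} (h : Nd x y z w) (j : Fin 4) :
    dl x j + dl y j + dl z j + dl w j = 1 := by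
  have hc := Nd_cover x y z w h j
  obtain ⟨a, b, c, d, e, f⟩ := h
  rcases hc with rfl | rfl | rfl | rfl <;> simp [dl, *]
  all_goals simp [a.symm, b.symm, c.symm, d.symm, e.symm, f.symm]

/-- The abstract setting. -/
structure Sys (C : ℤ) (k : Fin 4 → ℤ) (mm : Ht → Ht) (M N : (Fin 3 → ℝ) → (Fin 3 → ℝ))
    (τ : Ht → Set (Fin 3 → ℝ)) : Prop where
  MN : ∀ x, M (N x) = x
  NM : ∀ x, N (M x) = x
  Ncont : Continuous N
  mm_dl : ∀ h x, mm (h + dl x) = up (mm h + dl (x+1)) (-k x)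
  sub : ∀ h x, x ∈ τ h ↔ ∃ i, 0 ≤ i ∧ i < C ∧ M x ∈ τ (up (mm h) i)
  congr : ∀ h h' c, (∀ j, h j = h' j + c) → τ h = τ h'
  cpt : ∀ h, IsCompact (τ h)
  ne : ∀ h, (τ h).Nonempty
  uniq : ∀ x y, (∀ n, ∃ h h' : Ht, (∀ j, |h j - h' j| ≤ 1) ∧ M^[n] x ∈ τ h ∧ M^[n] y ∈ τ h') → x = y
  k3 : k 3 = 1 - C
  k0 : 0 ≤ k 0
  k1 : 0 ≤ k 1
  k2 : 1 ≤ k 2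
  ksum : k 0 + k 1 + k 2 + k 3 = 0

/-- The neighbor condition -/
def Spr (τ : Ht → Set (Fin 3 → ℝ)) : Prop :=
  ∀ h h' x, x ∈ τ h → x ∈ τ h' → ∀ p q, (h p - h' p) - (h q - h' q) ≤ 1

/-- four-fold point -/
def IsV (τ : Ht → Set (Fin 3 → ℝ)) (h : Ht) (x y z : Fin 4) (Y : Fin 3 → ℝ) : Prop :=
  Y ∈ τ h ∧ Y ∈ τ (h + dl x) ∧ Y ∈ τ (h + dl x + dl y) ∧ Y ∈ τ (h + dl x + dl y + dl z)

/-- digit of the base tile in the shift -/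
def kap (C : ℤ) (k : Fin 4 → ℤ) (x y z : Fin 4) : ℤ :=
  if x = 3 then C - 1 else if y = 3 then C - 1 - k x else if z = 3 then C - 1 - k x - k y else 0

/-- approximating compact sets of a digit sequence -/
def Bset (N : (Fin 3 → ℝ) → (Fin 3 → ℝ)) (τ : Ht → Set (Fin 3 → ℝ)) :
    ℕ → (ℕ → Ht) → Set (Fin 3 → ℝ)
  | 0, g => τ (g 0)
  | n + 1, g => N '' Bset N τ n (fun i => g (i + 1))

section core
variable {C : ℤ} {k : Fin 4 → ℤ} {mm : Ht → Ht} {M N : (Fin 3 → ℝ) → (Fin 3 → ℝ)}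
    {τ : Ht → Set (Fin 3 → ℝ)}

theorem IsV_congr (S : Sys C k mm M N τ) {h h' : Ht} (c : ℤ) (hc : ∀ j, h j = h' j + c)
    {x y z : Fin 4} {Y : Fin 3 → ℝ} (H : IsV τ h x y z Y) : IsV τ h' x y z Y := by
  obtain ⟨h1, h2, h3, h4⟩ := H
  refine ⟨?_, ?_, ?_, ?_⟩
  · rwa [← S.congr h h' c hc]
  · rwa [← S.congr (h + dl x) (h' + dl x) c (fun j => by simp [hc]; ring)]
  · rwa [← S.congr (h + dl x + dl y) (h' + dl x + dl y) c (fun j => by simp [hc]; ring)]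
  · rwa [← S.congr (h + dl x + dl y + dl z) (h' + dl x + dl y + dl z) c
      (fun j => by simp [hc]; ring)]

theorem k_nn (S : Sys C k mm M N τ) : ∀ x, x ≠ 3 → 0 ≤ k x := by
  have h2 := S.k2
  intro x hx
  fin_cases x
  · exact S.k0
  · exact S.k1
  · exact (by norm_num : (0:ℤ) ≤ 1).trans h2
  · exact absurd rfl hx

theorem k_sum (S : Sys C k mm M N τ) {x y z w : Fin 4} (h : Nd x y z w) :
    k x + k y + k z + k w = 0 := by
  have := S.ksum
  have e : k x + k y + k z + k w = ∑ j, k j * (dl x j + dl y j + dl z j + dl w j) := by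
    simp [dl, mul_add, Finset.sum_add_distrib]
  rw [e]
  simp only [Nd_sum h, mul_one, Fin.sum_univ_four]
  exact this

theorem pt_exists (S : Sys C k mm M N τ) (g : ℕ → Ht) (d : ℕ → ℤ)
    (hg : ∀ n, 0 ≤ d n ∧ d n < C ∧ g (n+1) = up (mm (g n)) (d n)) :
    ∃ Y, ∀ n, M^[n] Y ∈ τ (g n) := by
  have hcpt : ∀ n g, IsCompact (Bset N τ n g) := by
    intro n
    induction n with
    | zero => intro g; exact S.cpt _
    | succ n ih => intro g; exact (ih _).image S.Ncont
  have hne : ∀ n g, (Bset N τ n g).Nonempty := by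
    intro n
    induction n with
    | zero => intro g; exact S.ne _
    | succ n ih => intro g; exact (ih _).image _
  have hmem : ∀ n g Y, Y ∈ Bset N τ n g → M^[n] Y ∈ τ (g n) := by
    intro n
    induction n with
    | zero => intro g Y h; exact h
    | succ n ih =>
      rintro g Y ⟨Z, hZ, rfl⟩
      rw [Function.iterate_succ_apply, S.MN]
      exact ih _ Z hZ
  have hanti : ∀ n (g : ℕ → Ht) (d : ℕ → ℤ),
      (∀ n, 0 ≤ d n ∧ d n < C ∧ g (n+1) = up (mm (g n)) (d n)) →
      Bset N τ (n+1) g ⊆ Bset N τ n g := by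
    intro n
    induction n with
    | zero =>
      rintro g d hg Y ⟨Z, hZ, rfl⟩
      refine (S.sub _ _).2 ⟨d 0, (hg 0).1, (hg 0).2.1, ?_⟩
      rw [S.MN, ← (hg 0).2.2]
      exact hZ
    | succ n ih =>
      intro g d hg
      exact Set.image_mono (ih (fun i => g (i+1)) (fun i => d (i+1)) (fun i => hg (i+1)))
  obtain ⟨Y, hY⟩ := IsCompact.nonempty_iInter_of_sequence_nonempty_isCompact_isClosed
    (fun n => Bset N τ n g) (fun n => hanti n g d hg) (fun n => hne n g) (hcpt 0 g)
    (fun n => (hcpt n g).isClosed)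
  exact ⟨Y, fun n => hmem n g Y (Set.mem_iInter.1 hY n)⟩

/-- index of arcs and vertices -/
structure Vt where
  h : Ht
  x : Fin 4
  y : Fin 4
  z : Fin 4
  w : Fin 4

def Vt.good (v : Vt) : Prop := Nd v.x v.y v.z v.w

def shv (C : ℤ) (k : Fin 4 → ℤ) (mm : Ht → Ht) (v : Vt) : Vt :=
  ⟨up (mm v.h) (kap C k v.x v.y v.z), v.x + 1, v.y + 1, v.z + 1, v.w + 1⟩

theorem kap_range (S : Sys C k mm M N τ) {x y z w : Fin 4} (h : Nd x y z w) :
    0 ≤ kap C k x y z ∧ kap C k x y z < C ∧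
    0 ≤ kap C k x y z + k x ∧ kap C k x y z + k x < C ∧
    0 ≤ kap C k x y z + k x + k y ∧ kap C k x y z + k x + k y < C ∧
    0 ≤ kap C k x y z + k x + k y + k z ∧ kap C k x y z + k x + k y + k z < C := by
  have hs := k_sum S h
  have h3 := S.k3
  have hx := k_nn S x
  have hy := k_nn S y
  have hz := k_nn S z
  have hw := k_nn S w
  have hc := Nd_cover x y z w h 3
  obtain ⟨a, b, c, d, e, f⟩ := h
  unfold kap
  rcases hc with rfl | rfl | rfl | rfl
  · have := hy a.symm; have := hz b.symm; have := hw c.symm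
    simp only [if_true]; omega
  · have := hx a; have := hz d.symm; have := hw e.symm
    simp only [if_true, a, if_false]; omega
  · have := hx b; have := hy d; have := hw f.symm
    simp only [if_true, b, d, if_false]; omega
  · have := hx c; have := hy e; have := hz f
    simp only [c, e, f, if_false]; omega

theorem IsV_exists (S : Sys C k mm M N τ) (v : Vt) (hv : v.good) :
    ∃ Y, IsV τ v.h v.x v.y v.z Y := by
  let s : ℕ → Vt := fun n => (shv C k mm)^[n] v
  have hs : ∀ n, s (n+1) = shv C k mm (s n) := fun n => Function.iterate_succ_apply' _ _ _
  have hgood : ∀ n, (s n).good := by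
    intro n
    induction n with
    | zero => exact hv
    | succ n ih => rw [hs]; exact Nd_shift _ _ _ _ ih
  have hr := fun n => kap_range S (hgood n)
  obtain ⟨Y0, h0⟩ := pt_exists S (fun n => (s n).h)
    (fun n => kap C k (s n).x (s n).y (s n).z) (fun n => ⟨(hr n).1, (hr n).2.1, by
      simp only [hs, shv]⟩)
  obtain ⟨Y1, h1⟩ := pt_exists S (fun n => (s n).h + dl (s n).x)
    (fun n => kap C k (s n).x (s n).y (s n).z + k (s n).x)
    (fun n => ⟨(hr n).2.2.1, (hr n).2.2.2.1, by
      simp only [hs, shv, S.mm_dl, up_add_dl, up_up]; congr 1; ring⟩)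
  obtain ⟨Y2, h2⟩ := pt_exists S (fun n => (s n).h + dl (s n).x + dl (s n).y)
    (fun n => kap C k (s n).x (s n).y (s n).z + k (s n).x + k (s n).y)
    (fun n => ⟨(hr n).2.2.2.2.1, (hr n).2.2.2.2.2.1, by
      simp only [hs, shv, S.mm_dl, up_add_dl, up_up]; congr 1; ring⟩)
  obtain ⟨Y3, h3⟩ := pt_exists S (fun n => (s n).h + dl (s n).x + dl (s n).y + dl (s n).z)
    (fun n => kap C k (s n).x (s n).y (s n).z + k (s n).x + k (s n).y + k (s n).z)
    (fun n => ⟨(hr n).2.2.2.2.2.2.1, (hr n).2.2.2.2.2.2.2, by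
      simp only [hs, shv, S.mm_dl, up_add_dl, up_up]; congr 1; ring⟩)
  have nn : ∀ x j, 0 ≤ dl x j := by intro x j; unfold dl; split_ifs <;> norm_num
  have e1 : Y0 = Y1 := S.uniq _ _ fun n => ⟨_, _, fun j => by
    have := Nd_sum (hgood n) j
    have a1 := nn (s n).x j; have a2 := nn (s n).y j; have a3 := nn (s n).z j
    have a4 := nn (s n).w j
    simp only [Pi.add_apply]
    rw [abs_le]; constructor <;> linarith, h0 n, h1 n⟩
  have e2 : Y0 = Y2 := S.uniq _ _ fun n => ⟨_, _, fun j => by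
    have := Nd_sum (hgood n) j
    have a1 := nn (s n).x j; have a2 := nn (s n).y j; have a3 := nn (s n).z j
    have a4 := nn (s n).w j
    simp only [Pi.add_apply]
    rw [abs_le]; constructor <;> linarith, h0 n, h2 n⟩
  have e3 : Y0 = Y3 := S.uniq _ _ fun n => ⟨_, _, fun j => by
    have := Nd_sum (hgood n) j
    have a1 := nn (s n).x j; have a2 := nn (s n).y j; have a3 := nn (s n).z j
    have a4 := nn (s n).w j
    simp only [Pi.add_apply]
    rw [abs_le]; constructor <;> linarith, h0 n, h3 n⟩
  subst e1 e2 e3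
  exact ⟨Y0, h0 0, h1 0, h2 0, h3 0⟩

/-- basic consequence of the neighbor condition -/
theorem step_le (hs : Spr τ) {g : Ht} {i j : ℤ} {p : Fin 4} (hp : p ≠ 0) {Y : Fin 3 → ℝ}
    (h1 : Y ∈ τ (up g i)) (h2 : Y ∈ τ (up (g + dl p) j)) : i ≤ j ∧ j ≤ i + 1 := by
  obtain ⟨q, hq0, hqp⟩ : ∃ q : Fin 4, q ≠ 0 ∧ q ≠ p := by
    have : ∀ p : Fin 4, ∃ q : Fin 4, q ≠ 0 ∧ q ≠ p := by decide
    exact this p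
  have e1 := hs _ _ _ h1 h2 0 p
  have e2 := hs _ _ _ h1 h2 q 0
  simp [up, dl, hp, hp.symm, hq0, hqp] at e1 e2
  constructor <;> linarith

theorem succ_ne_zero4 : ∀ {x : Fin 4}, x ≠ 3 → x + 1 ≠ 0 := by decide

theorem IsV_shift (S : Sys C k mm M N τ) (hs : Spr τ) {h : Ht} {x y z w : Fin 4}
    (hv : Nd x y z w) {Y : Fin 3 → ℝ} (H : IsV τ h x y z Y) :
    IsV τ (up (mm h) (kap C k x y z)) (x+1) (y+1) (z+1) (M Y) := by
  obtain ⟨h1, h2, h3, h4⟩ := H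
  obtain ⟨i1, l1, u1, m1⟩ := (S.sub _ _).1 h1
  obtain ⟨i2, l2, u2, m2⟩ := (S.sub _ _).1 h2
  obtain ⟨i3, l3, u3, m3⟩ := (S.sub _ _).1 h3
  obtain ⟨i4, l4, u4, m4⟩ := (S.sub _ _).1 h4
  simp only [S.mm_dl, up_add_dl, up_up] at m2 m3 m4
  have m1' : M Y ∈ τ (up (mm h + dl (x+1) + dl (y+1) + dl (z+1) + dl (w+1)) i1) := by
    rwa [S.congr _ (up (mm h) i1) 1 (fun j => by
      have := Nd_sum (Nd_shift _ _ _ _ hv) j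
      simp only [up, Pi.add_apply]; linarith)]
  have k3 := S.k3
  have ks := k_sum S hv
  have c1 : i1 ≤ -k x + i2 := by
    by_cases hx : x = 3
    · subst hx; omega
    · exact (step_le hs (succ_ne_zero4 hx) m1 m2).1
  have c2 : -k x + i2 ≤ -k x + -k y + i3 := by
    by_cases hx : y = 3
    · subst hx; omega
    · exact (step_le hs (succ_ne_zero4 hx) m2 m3).1
  have c3 : -k x + -k y + i3 ≤ -k x + -k y + -k z + i4 := by
    by_cases hx : z = 3
    · subst hx; omega
    · exact (step_le hs (succ_ne_zero4 hx) m3 m4).1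
  have c4 : -k x + -k y + -k z + i4 ≤ i1 := by
    by_cases hx : w = 3
    · subst hx; omega
    · exact (step_le hs (succ_ne_zero4 hx) m4 m1').1
  have ek : kap C k x y z = i1 := by
    unfold kap
    split_ifs with a b c
    · subst a; omega
    · subst b; omega
    · subst c; omega
    · have : w = 3 := by
        rcases Nd_cover x y z w hv 3 with h | h | h | h
        · exact absurd h.symm a
        · exact absurd h.symm b
        · exact absurd h.symm c
        · exact h.symm
      subst this; omega
  have e2 : -k x + i2 = i1 := by omega
  have e3 : -k x + -k y + i3 = i1 := by omega
  have e4 : -k x + -k y + -k z + i4 = i1 := by omega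
  rw [e2] at m2
  rw [e3] at m3
  rw [e4] at m4
  rw [ek]
  refine ⟨m1, ?_, ?_, ?_⟩ <;> simpa only [up_add_dl]

theorem IsV_unique (S : Sys C k mm M N τ) (hs : Spr τ) {h : Ht} {x y z w : Fin 4}
    (hv : Nd x y z w) {Y Y' : Fin 3 → ℝ} (H : IsV τ h x y z Y) (H' : IsV τ h x y z Y') :
    Y = Y' := by
  refine S.uniq _ _ fun n => ?_
  have : ∀ n h x y z w Y Y', Nd x y z w → IsV τ h x y z Y → IsV τ h x y z Y' →
      ∃ g, M^[n] Y ∈ τ g ∧ M^[n] Y' ∈ τ g := by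
    intro n
    induction n with
    | zero => intro h x y z w Y Y' _ H H'; exact ⟨h, H.1, H'.1⟩
    | succ n ih =>
      intro h x y z w Y Y' hv H H'
      simp only [Function.iterate_succ_apply]
      exact ih _ _ _ _ _ _ _ (Nd_shift _ _ _ _ hv) (IsV_shift S hs hv H) (IsV_shift S hs hv H')
  obtain ⟨g, h1, h2⟩ := this n h x y z w Y Y' hv H H'
  exact ⟨g, g, by simp, h1, h2⟩

/-- In the degenerate case `k 1 = 0` there would be more neighbors. -/
theorem k1_pos (S : Sys C k mm M N τ) (hs : Spr τ) : 1 ≤ k 1 := by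
  by_contra hcon
  have k10 : k 1 = 0 := by have := S.k1; omega
  have key : ∀ n h x y z w Y Y', Nd x y z w →
      (x = 3 ∧ y = 1 ∨ x = 1 ∧ y = 3 ∨ x = 0 ∧ y = 2 ∨ x = 2 ∧ y = 0) →
      IsV τ h x y z Y → IsV τ h y x z Y' → ∃ g, M^[n] Y ∈ τ g ∧ M^[n] Y' ∈ τ g := by
    intro n
    induction n with
    | zero => intro h x y z w Y Y' _ _ H H'; exact ⟨h, H.1, H'.1⟩
    | succ n ih =>
      intro h x y z w Y Y' hv hxy H H'
      simp only [Function.iterate_succ_apply]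
      have ek : kap C k y x z = kap C k x y z := by
        rcases hxy with ⟨rfl, rfl⟩ | ⟨rfl, rfl⟩ | ⟨rfl, rfl⟩ | ⟨rfl, rfl⟩ <;> simp [kap, k10]
        all_goals split_ifs <;> ring
      have H2 := IsV_shift S hs (Nd_swap hv) H'
      rw [ek] at H2
      refine ih _ _ _ _ _ _ _ (Nd_shift _ _ _ _ hv) ?_ (IsV_shift S hs hv H) H2
      rcases hxy with ⟨rfl, rfl⟩ | ⟨rfl, rfl⟩ | ⟨rfl, rfl⟩ | ⟨rfl, rfl⟩ <;> decide
  have n1 : Nd 3 1 0 2 := by decide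
  obtain ⟨Y, hY⟩ := IsV_exists S ⟨0, 3, 1, 0, 2⟩ n1
  obtain ⟨Y', hY'⟩ := IsV_exists S ⟨0, 1, 3, 0, 2⟩ (Nd_swap n1)
  have e : Y = Y' := S.uniq _ _ fun n => by
    obtain ⟨g, h1, h2⟩ := key n 0 3 1 0 2 Y Y' n1 (by decide) hY hY'
    exact ⟨g, g, by simp, h1, h2⟩
  subst e
  have := hs _ _ _ hY.2.1 hY'.2.1 3 1
  simp [dl] at this

end core

/-- sequence of tiles along an arc -/
def Wt (g : Ht) (a b c : Fin 4) (s : ℤ) : Ht := fun j =>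
  g j - (if j = c then (s+2)/3 else if j = b then (s+1)/3 else if j = a then s/3 else 0)

def ct (a b c : Fin 4) (s : ℤ) : Fin 4 := if s % 3 = 0 then c else if s % 3 = 1 then b else a

def ach (g : Ht) (a b c : Fin 4) (s : ℤ) : Vt :=
  ⟨Wt g a b c s, ct a b c (s+2), 0, ct a b c (s+1), ct a b c s⟩

def rv (v : Vt) : Vt := ⟨v.h, v.y, v.x, v.z, v.w⟩

def Kset (τ : Ht → Set (Fin 3 → ℝ)) (v : Vt) : Set (Fin 3 → ℝ) :=
  τ v.h ∩ τ (v.h + dl v.x + dl v.y) ∩ τ (v.h + dl v.x + dl v.y + dl v.z)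

noncomputable def pt (τ : Ht → Set (Fin 3 → ℝ)) (v : Vt) : Fin 3 → ℝ :=
  Classical.epsilon (IsV τ v.h v.x v.y v.z)

section arcs
variable {C : ℤ} {k : Fin 4 → ℤ} {mm : Ht → Ht} {M N : (Fin 3 → ℝ) → (Fin 3 → ℝ)}
    {τ : Ht → Set (Fin 3 → ℝ)}

theorem pt_spec (S : Sys C k mm M N τ) {v : Vt} (hv : v.good) : IsV τ v.h v.x v.y v.z (pt τ v) :=
  Classical.epsilon_spec (IsV_exists S v hv)

theorem pt_eq (S : Sys C k mm M N τ) (hs : Spr τ) {v : Vt} (hv : v.good) {Y : Fin 3 → ℝ}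
    (H : IsV τ v.h v.x v.y v.z Y) : Y = pt τ v :=
  IsV_unique S hs hv H (pt_spec S hv)

theorem rv_good {v : Vt} (hv : v.good) : (rv v).good := Nd_swap hv

theorem Kset_rv (v : Vt) : Kset τ (rv v) = Kset τ v := by
  have : v.h + dl v.y + dl v.x = v.h + dl v.x + dl v.y := by abel
  simp only [Kset, rv, this]

theorem Wt_zero {g : Ht} {a b c : Fin 4} : Wt g a b c 0 = g := by
  funext j; simp [Wt]

theorem Wt_succ {g : Ht} {a b c : Fin 4} (hn : Nd a 0 b c) (s : ℤ) (j : Fin 4) :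
    Wt g a b c (s+1) j = Wt g a b c s j - dl (ct a b c s) j := by
  have hj := Nd_cover _ _ _ _ hn j
  obtain ⟨h1, h2, h3, h4, h5, h6⟩ := hn
  have e : s % 3 = 0 ∨ s % 3 = 1 ∨ s % 3 = 2 := by omega
  rcases e with e | e | e <;> rcases hj with rfl | rfl | rfl | rfl <;>
    simp [Wt, ct, dl, e, h1, h2, h3, h4, h5, h6, h1.symm, h2.symm, h3.symm, h4.symm,
      h5.symm, h6.symm] <;> omega

theorem ct_add_three (a b c : Fin 4) (s : ℤ) : ct a b c (s+3) = ct a b c s := by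
  simp [ct]

theorem ct_sub_one (a b c : Fin 4) (s : ℤ) : ct a b c (s-1) = ct a b c (s+2) := by
  rw [← ct_add_three a b c (s-1)]; congr 1; ring

theorem ach_good {a b c : Fin 4} (hn : Nd a 0 b c) (g : Ht) (s : ℤ) : (ach g a b c s).good := by
  obtain ⟨h1, h2, h3, h4, h5, h6⟩ := hn
  have e : s % 3 = 0 ∨ s % 3 = 1 ∨ s % 3 = 2 := by omega
  rcases e with e | e | e
  · have e1 : (s+1) % 3 = 1 := by omega
    have e2 : (s+2) % 3 = 2 := by omega
    simp only [Vt.good, ach, ct, e, e1, e2]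
    exact ⟨h1, h2, h3, h4, h5, h6⟩
  · have e1 : (s+1) % 3 = 2 := by omega
    have e2 : (s+2) % 3 = 0 := by omega
    simp only [Vt.good, ach, ct, e, e1, e2]
    exact ⟨h5.symm, h3.symm, h6.symm, h1.symm, h4, h2⟩
  · have e1 : (s+1) % 3 = 0 := by omega
    have e2 : (s+2) % 3 = 1 := by omega
    simp only [Vt.good, ach, ct, e, e1, e2]
    exact ⟨h4.symm, h6, h2.symm, h5, h1.symm, h3.symm⟩

section
variable {g : Ht} {a b c : Fin 4}

theorem tile1 (S : Sys C k mm M N τ) (hn : Nd a 0 b c) (s : ℤ) :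
    τ (Wt g a b c s + dl (ct a b c (s+2)) + dl 0 + dl (ct a b c (s+1))) = τ (Wt g a b c (s+1)) := by
  refine S.congr _ _ 1 fun j => ?_
  have := Nd_sum (ach_good hn g s) j
  rw [Wt_succ hn]
  simp only [ach, Pi.add_apply] at this ⊢
  linarith

theorem tile2 (S : Sys C k mm M N τ) (hn : Nd a 0 b c) (s : ℤ) :
    τ (Wt g a b c s + dl (ct a b c (s+2)) + dl 0) = τ (Wt g a b c (s+2)) := by
  refine S.congr _ _ 1 fun j => ?_
  have := Nd_sum (ach_good hn g s) j
  have e : s + 2 = s + 1 + 1 := by ring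
  rw [e, Wt_succ hn, Wt_succ hn, ← e]
  simp only [ach, Pi.add_apply] at this ⊢
  linarith

theorem tile3 (S : Sys C k mm M N τ) (hn : Nd a 0 b c) (s : ℤ) :
    τ (Wt g a b c s + dl 0) = τ (Wt g a b c (s+3)) := by
  refine S.congr _ _ 1 fun j => ?_
  have := Nd_sum (ach_good hn g s) j
  have e : s + 3 = s + 2 + 1 := by ring
  have e' : s + 2 = s + 1 + 1 := by ring
  rw [e, Wt_succ hn, e', Wt_succ hn, Wt_succ hn, ← e']
  simp only [ach, Pi.add_apply] at this ⊢
  linarith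

theorem tileP (hn : Nd a 0 b c) (s : ℤ) :
    Wt g a b c s + dl (ct a b c (s+2)) = Wt g a b c (s-1) := by
  funext j
  have := Wt_succ (g := g) hn (s-1) j
  rw [ct_sub_one, sub_add_cancel] at this
  simp only [Pi.add_apply]
  linarith

theorem mem_K_ach (S : Sys C k mm M N τ) (hn : Nd a 0 b c) (s : ℤ) (Y : Fin 3 → ℝ) :
    Y ∈ Kset τ (ach g a b c s) ↔
      Y ∈ τ (Wt g a b c s) ∧ Y ∈ τ (Wt g a b c (s+1)) ∧ Y ∈ τ (Wt g a b c (s+2)) := by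
  simp only [Kset, ach, tile1 S hn, tile2 S hn, Set.mem_inter_iff]
  tauto

theorem IsV_ach (S : Sys C k mm M N τ) (hn : Nd a 0 b c) (s : ℤ) (Y : Fin 3 → ℝ) :
    IsV τ (ach g a b c s).h (ach g a b c s).x (ach g a b c s).y (ach g a b c s).z Y ↔
      Y ∈ τ (Wt g a b c (s-1)) ∧
      Y ∈ τ (Wt g a b c s) ∧ Y ∈ τ (Wt g a b c (s+1)) ∧ Y ∈ τ (Wt g a b c (s+2)) := by
  simp only [IsV, ach, tile1 S hn, tile2 S hn]
  rw [tileP hn]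
  tauto

theorem IsV_rv_ach (S : Sys C k mm M N τ) (hn : Nd a 0 b c) (s : ℤ) (Y : Fin 3 → ℝ) :
    IsV τ (rv (ach g a b c s)).h (rv (ach g a b c s)).x (rv (ach g a b c s)).y
      (rv (ach g a b c s)).z Y ↔
      Y ∈ τ (Wt g a b c s) ∧ Y ∈ τ (Wt g a b c (s+1)) ∧ Y ∈ τ (Wt g a b c (s+2)) ∧
      Y ∈ τ (Wt g a b c (s+3)) := by
  have : ∀ u v : Ht, u + dl 0 + v = u + v + dl 0 := fun u v => by abel
  simp only [IsV, ach, rv]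
  rw [tile3 S hn, this, tile1 S hn, tile2 S hn]
  tauto

theorem far_ach (hs : Spr τ) (hn : Nd a 0 b c) {s t : ℤ} {Y : Fin 3 → ℝ}
    (h1 : Y ∈ τ (Wt g a b c s)) (h2 : Y ∈ τ (Wt g a b c t)) : t < s + 4 := by
  have e1 := hs _ _ _ h1 h2 a 0
  have e2 := hs _ _ _ h1 h2 b 0
  have e3 := hs _ _ _ h1 h2 c 0
  obtain ⟨h1, h2, h3, h4, h5, h6⟩ := hn
  simp [Wt, h1, h2, h3, h4, h5, h6, h1.symm, h2.symm, h3.symm, h4.symm,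
      h5.symm, h6.symm] at e1 e2 e3
  omega

theorem ach_glue (S : Sys C k mm M N τ) (hs : Spr τ) (hn : Nd a 0 b c) {s t : ℤ} (ht : t = s + 1) :
    pt τ (rv (ach g a b c s)) = pt τ (ach g a b c t) := by
  subst ht
  apply pt_eq S hs (ach_good hn _ _)
  rw [IsV_ach S hn]
  have := (IsV_rv_ach S hn s _).1 (pt_spec S (rv_good (ach_good hn g s)))
  rw [show s + 1 - 1 = s by ring, show s + 1 + 1 = s + 2 by ring, show s + 1 + 2 = s + 3 by ring]
  exact this

theorem ach_overlap (S : Sys C k mm M N τ) (hs : Spr τ) (hn : Nd a 0 b c) {s t : ℤ} (hst : s < t)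
    {Y : Fin 3 → ℝ} (h1 : Y ∈ Kset τ (ach g a b c s)) (h2 : Y ∈ Kset τ (ach g a b c t)) :
    t = s + 1 ∧ Y = pt τ (rv (ach g a b c s)) := by
  rw [mem_K_ach S hn] at h1 h2
  have := far_ach hs hn h1.1 h2.2.2
  have ht : t = s + 1 := by omega
  refine ⟨ht, pt_eq S hs (rv_good (ach_good hn _ _)) ?_⟩
  rw [IsV_rv_ach S hn]
  subst ht
  refine ⟨h1.1, h1.2.1, h1.2.2, ?_⟩
  have := h2.2.2
  rwa [show s + 1 + 2 = s + 3 by ring] at this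

end
theorem Wt_r0 (S : Sys C k mm M N τ) {a b c : Fin 4} (hn : Nd a 0 b c) (G : Ht) (m r s n : ℤ)
    (h : s = 3 * r) (h' : n = m + r) : τ (Wt (up G m) a b c s) = τ (up G n) := by
  subst h h'
  refine S.congr _ _ (-r) fun j => ?_
  have hj := Nd_cover _ _ _ _ hn j
  obtain ⟨h1, h2, h3, h4, h5, h6⟩ := hn
  rcases hj with rfl | rfl | rfl | rfl <;>
    simp [Wt, up, h1, h2, h3, h4, h5, h6, h1.symm, h2.symm, h3.symm, h4.symm,
      h5.symm, h6.symm] <;> omega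

theorem Wt_r1 (S : Sys C k mm M N τ) {a b c : Fin 4} (hn : Nd a 0 b c) (G : Ht) (m r s n : ℤ)
    (h : s = 3 * r + 1) (h' : n = m + 1 + r) :
    τ (Wt (up G m) a b c s) = τ (up (G + dl a + dl b) n) := by
  subst h h'
  refine S.congr _ _ (-r-1) fun j => ?_
  have hj := Nd_cover _ _ _ _ hn j
  obtain ⟨h1, h2, h3, h4, h5, h6⟩ := hn
  rcases hj with rfl | rfl | rfl | rfl <;>
    simp [Wt, up, dl, h1, h2, h3, h4, h5, h6, h1.symm, h2.symm, h3.symm, h4.symm,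
      h5.symm, h6.symm] <;> omega

theorem Wt_r2 (S : Sys C k mm M N τ) {a b c : Fin 4} (hn : Nd a 0 b c) (G : Ht) (m r s n : ℤ)
    (h : s = 3 * r + 2) (h' : n = m + 1 + r) :
    τ (Wt (up G m) a b c s) = τ (up (G + dl a) n) := by
  subst h h'
  refine S.congr _ _ (-r-1) fun j => ?_
  have hj := Nd_cover _ _ _ _ hn j
  obtain ⟨h1, h2, h3, h4, h5, h6⟩ := hn
  rcases hj with rfl | rfl | rfl | rfl <;>
    simp [Wt, up, dl, h1, h2, h3, h4, h5, h6, h1.symm, h2.symm, h3.symm, h4.symm,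
      h5.symm, h6.symm] <;> omega

/-- child of an arc of increasing type -/
def ich (C : ℤ) (k : Fin 4 → ℤ) (mm : Ht → Ht) (v : Vt) (s : ℤ) : Vt :=
  ach (up (mm v.h) (C - 1 - k v.x)) (v.x + 1) (v.z + 1) (v.w + 1) s

theorem Nd_inc {x z w : Fin 4} (hv : Nd x 3 z w) : Nd (x+1) 0 (z+1) (w+1) := Nd_shift _ _ _ _ hv

theorem inc_cover (S : Sys C k mm M N τ) (hs : Spr τ) {h : Ht} {x z w : Fin 4} (hv : Nd x 3 z w)
    (Y : Fin 3 → ℝ) : Y ∈ Kset τ ⟨h, x, 3, z, w⟩ ↔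
      ∃ s : ℤ, 0 ≤ s ∧ s ≤ 3 * k x ∧ M Y ∈ Kset τ (ich C k mm ⟨h, x, 3, z, w⟩ s) := by
  have hn := Nd_inc hv
  have k3 := S.k3
  have ks := k_sum S hv
  have kx := k_nn S x hv.1
  have kz := k_nn S z hv.2.2.2.1.symm
  have kw := k_nn S w hv.2.2.2.2.1.symm
  have e2 : ∀ j, up (mm (h + dl x + dl 3)) j = up (mm h + dl (x+1)) (C - k x + j) := by
    intro j
    simp only [S.mm_dl, up_add_dl, up_up]
    rw [show (3 : Fin 4) + 1 = 0 from rfl, add_dl_zero, up_up]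
    congr 1
    omega
  have e3 : ∀ j, up (mm (h + dl x + dl 3 + dl z)) j =
      up (mm h + dl (x+1) + dl (z+1)) (C - k x - k z + j) := by
    intro j
    rw [S.mm_dl, up_up, ← up_add_dl]
    rw [← sub_add_cancel (mm (h + dl x + dl 3)) 0, sub_zero]
    have := e2 (-k z + j)
    have e0 : ∀ g : Ht, g + 0 = g := fun g => add_zero g
    rw [e0, this, up_add_dl]
    congr 1
    ring
  simp only [ich, mem_K_ach S hn]
  simp only [Kset, Set.mem_inter_iff]
  constructor
  · rintro ⟨⟨h1, h2⟩, h3⟩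
    obtain ⟨i, l1, u1, m1⟩ := (S.sub _ _).1 h1
    obtain ⟨j, l2, u2, m2⟩ := (S.sub _ _).1 h2
    obtain ⟨l, l3, u3, m3⟩ := (S.sub _ _).1 h3
    rw [e2] at m2
    rw [e3] at m3
    have c1 := step_le hs hn.1 m1 m2
    have c2 := step_le hs hn.2.2.2.1.symm m2 m3
    have m1' : M Y ∈ τ (up (mm h + dl (x+1) + dl (z+1) + dl (w+1)) (i + 1)) := by
      rwa [S.congr _ (up (mm h) i) 1 (fun j => by
        have := Nd_sum hn j
        have e : up (mm h + dl (x+1) + dl (z+1) + dl (w+1)) (i + 1) j =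
          up (mm h) i j + (dl (x+1) j + dl 0 j + dl (z+1) j + dl (w+1) j) := by
          simp only [up, dl, Pi.add_apply]; split_ifs <;> ring
        rw [e, this])]
    have c3 := step_le hs hn.2.2.2.2.1.symm m3 m1'
    have cases3 : (i = C - k x + j ∧ C - k x - k z + l = C - k x + j) ∨
        (i = C - k x + j ∧ C - k x - k z + l = C - k x + j + 1) ∨
        (i = C - 1 - k x + j ∧ C - k x - k z + l = C - k x + j) := by omega
    rcases cases3 with ⟨a1, a2⟩ | ⟨a1, a2⟩ | ⟨a1, a2⟩
    · refine ⟨3 * j + 1, by omega, by omega, ?_, ?_, ?_⟩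
      · rwa [Wt_r1 S hn (mm h) (C - 1 - k x) j _ _ (by ring) (show C - k x - k z + l = _ by omega)]
      · rwa [Wt_r2 S hn (mm h) (C - 1 - k x) j _ _ (by ring) (show C - k x + j = _ by omega)]
      · rwa [Wt_r0 S hn (mm h) (C - 1 - k x) (j+1) _ _ (by ring) (show i = _ by omega)]
    · refine ⟨3 * j + 2, by omega, by omega, ?_, ?_, ?_⟩
      · rwa [Wt_r2 S hn (mm h) (C - 1 - k x) j _ _ (by ring) (show C - k x + j = _ by omega)]
      · rwa [Wt_r0 S hn (mm h) (C - 1 - k x) (j+1) _ _ (by ring) (show i = _ by omega)]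
      · rwa [Wt_r1 S hn (mm h) (C - 1 - k x) (j+1) _ _ (by ring)
          (show C - k x - k z + l = _ by omega)]
    · refine ⟨3 * j, by omega, by omega, ?_, ?_, ?_⟩
      · rwa [Wt_r0 S hn (mm h) (C - 1 - k x) j _ _ (by ring) (show i = _ by omega)]
      · rwa [Wt_r1 S hn (mm h) (C - 1 - k x) j _ _ (by ring) (show C - k x - k z + l = _ by omega)]
      · rwa [Wt_r2 S hn (mm h) (C - 1 - k x) j _ _ (by ring) (show C - k x + j = _ by omega)]
  · rintro ⟨s, s0, s1, h1, h2, h3⟩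
    have es : ∃ r, s = 3 * r ∨ s = 3 * r + 1 ∨ s = 3 * r + 2 := ⟨s / 3, by omega⟩
    obtain ⟨r, es | es | es⟩ := es
    · rw [Wt_r0 S hn (mm h) (C - 1 - k x) r _ _ (by omega) rfl] at h1
      rw [Wt_r1 S hn (mm h) (C - 1 - k x) r _ (C - k x - k z + (k z + r)) (by omega) (by omega)] at h2
      rw [Wt_r2 S hn (mm h) (C - 1 - k x) r _ (C - k x + r) (by omega) (by omega)] at h3
      refine ⟨⟨(S.sub _ _).2 ⟨_, ?_, ?_, h1⟩, (S.sub _ _).2 ⟨r, ?_, ?_, by rwa [e2]⟩⟩,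
        (S.sub _ _).2 ⟨k z + r, ?_, ?_, by rwa [e3]⟩⟩ <;> omega
    · rw [Wt_r1 S hn (mm h) (C - 1 - k x) r _ (C - k x - k z + (k z + r)) (by omega) (by omega)] at h1
      rw [Wt_r2 S hn (mm h) (C - 1 - k x) r _ (C - k x + r) (by omega) (by omega)] at h2
      rw [Wt_r0 S hn (mm h) (C - 1 - k x) (r+1) _ _ (by omega) rfl] at h3
      refine ⟨⟨(S.sub _ _).2 ⟨_, ?_, ?_, h3⟩, (S.sub _ _).2 ⟨r, ?_, ?_, by rwa [e2]⟩⟩,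
        (S.sub _ _).2 ⟨k z + r, ?_, ?_, by rwa [e3]⟩⟩ <;> omega
    · rw [Wt_r2 S hn (mm h) (C - 1 - k x) r _ (C - k x + r) (by omega) (by omega)] at h1
      rw [Wt_r0 S hn (mm h) (C - 1 - k x) (r+1) _ _ (by omega) rfl] at h2
      rw [Wt_r1 S hn (mm h) (C - 1 - k x) (r+1) _ (C - k x - k z + (k z + r + 1))
        (by omega) (by omega)] at h3
      refine ⟨⟨(S.sub _ _).2 ⟨_, ?_, ?_, h2⟩, (S.sub _ _).2 ⟨r, ?_, ?_, by rwa [e2]⟩⟩,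
        (S.sub _ _).2 ⟨k z + r + 1, ?_, ?_, by rwa [e3]⟩⟩ <;> omega

theorem inc_first (S : Sys C k mm M N τ) (hs : Spr τ) {h : Ht} {x z w : Fin 4} (hv : Nd x 3 z w) :
    M (pt τ ⟨h, x, 3, z, w⟩) = pt τ (ich C k mm ⟨h, x, 3, z, w⟩ 0) := by
  have hn := Nd_inc hv
  apply pt_eq S hs (ach_good hn _ _)
  have := IsV_shift S hs hv (pt_spec S (v := ⟨h, x, 3, z, w⟩) hv)
  simp only [kap, hv.1, if_false, if_true] at this
  simp only [ich, ach, Wt_zero]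
  exact this

theorem inc_last (S : Sys C k mm M N τ) (hs : Spr τ) {h : Ht} {x z w : Fin 4} (hv : Nd x 3 z w) :
    M (pt τ (rv ⟨h, x, 3, z, w⟩)) = pt τ (rv (ich C k mm ⟨h, x, 3, z, w⟩ (3 * k x))) := by
  have hn := Nd_inc hv
  apply pt_eq S hs (rv_good (ach_good hn _ _))
  have := IsV_shift S hs (Nd_swap hv) (pt_spec S (v := ⟨h, 3, x, z, w⟩) (Nd_swap hv))
  simp only [kap, if_true] at this
  simp only [ich, ach, rv, ct]
  have r1 : (3 * k x + 2) % 3 = 2 := by omega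
  have r2 : (3 * k x + 1) % 3 = 1 := by omega
  simp only [r1, r2]
  refine IsV_congr S (k x) (fun j => ?_) this
  have hj := Nd_cover _ _ _ _ hn j
  obtain ⟨h1, h2, h3, h4, h5, h6⟩ := hn
  rcases hj with rfl | rfl | rfl | rfl <;>
    simp [Wt, up, h1, h2, h3, h4, h5, h6, h1.symm, h2.symm, h3.symm, h4.symm,
      h5.symm, h6.symm] <;> omega
/-- local chain data at a vertex -/
structure Loc (M : (Fin 3 → ℝ) → (Fin 3 → ℝ)) (τ : Ht → Set (Fin 3 → ℝ)) (n : ℕ) (c : ℕ → Vt)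
    (v : Vt) : Prop where
  npos : 0 < n
  gch : ∀ i, i < n → (c i).good
  cover : ∀ Y, Y ∈ Kset τ v ↔ ∃ i, i < n ∧ M Y ∈ Kset τ (c i)
  pfirst : M (pt τ v) = pt τ (c 0)
  qlast : M (pt τ (rv v)) = pt τ (rv (c (n-1)))
  glue : ∀ i, i + 1 < n → pt τ (rv (c i)) = pt τ (c (i+1))
  overlap : ∀ i j Y, i < j → j < n → Y ∈ Kset τ (c i) → Y ∈ Kset τ (c j) →
    j = i + 1 ∧ Y = pt τ (rv (c i))

theorem rv_rv (v : Vt) : rv (rv v) = v := rfl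

theorem Loc_rv {n : ℕ} {c : ℕ → Vt} {v : Vt} (H : Loc M τ n c v) :
    Loc M τ n (fun i => rv (c (n - 1 - i))) (rv v) where
  npos := H.npos
  gch := fun i hi => rv_good (H.gch _ (by omega))
  cover := fun Y => by
    rw [Kset_rv, H.cover]
    constructor
    · rintro ⟨i, hi, h⟩
      refine ⟨n - 1 - i, by omega, ?_⟩
      rw [Kset_rv, show n - 1 - (n - 1 - i) = i by omega]
      exact h
    · rintro ⟨i, hi, h⟩
      rw [Kset_rv] at h
      exact ⟨_, by omega, h⟩
  pfirst := by simpa using H.qlast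
  qlast := by simpa [rv_rv] using H.pfirst
  glue := fun i hi => by
    rw [rv_rv]
    have := H.glue (n - 1 - (i+1)) (by omega)
    rw [this]
    congr 2
    omega
  overlap := fun i j Y hij hj h1 h2 => by
    rw [Kset_rv] at h1 h2
    obtain ⟨a, b⟩ := H.overlap (n-1-j) (n-1-i) Y (by omega) (by omega) h2 h1
    refine ⟨by omega, ?_⟩
    rw [rv_rv, a, ← H.glue _ (by omega)]
    exact b

theorem Loc_inc (S : Sys C k mm M N τ) (hs : Spr τ) {h : Ht} {x z w : Fin 4} (hv : Nd x 3 z w) :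
    Loc M τ (3 * (k x).toNat + 1) (fun i => ich C k mm ⟨h, x, 3, z, w⟩ i) ⟨h, x, 3, z, w⟩ := by
  have hn := Nd_inc hv
  have kx := k_nn S x hv.1
  constructor
  · omega
  · intro i _; exact ach_good hn _ _
  · intro Y
    rw [inc_cover S hs hv]
    constructor
    · rintro ⟨s, s0, s1, h⟩
      refine ⟨s.toNat, by omega, ?_⟩
      rw [Int.toNat_of_nonneg s0]
      exact h
    · rintro ⟨i, hi, h⟩
      exact ⟨i, by omega, by omega, h⟩
  · exact inc_first S hs hv
  · have e : ((3 * (k x).toNat + 1 - 1 : ℕ) : ℤ) = 3 * k x := by omega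
    rw [inc_last S hs hv, e]
  · intro i _
    exact ach_glue S hs hn (by push_cast; ring)
  · intro i j Y hij _ h1 h2
    obtain ⟨a, b⟩ := ach_overlap S hs hn (by exact_mod_cast hij) h1 h2
    exact ⟨by omega, b⟩

theorem shv_rv (v : Vt) (hx : v.x ≠ 3) (hy : v.y ≠ 3) :
    shv C k mm (rv v) = rv (shv C k mm v) := by
  simp only [shv, rv, kap, hx, hy, if_false]
  congr 2
  by_cases hz : v.z = 3
  · simp only [hz, if_true]; ring
  · simp only [hz, if_false]

theorem Loc_shift (S : Sys C k mm M N τ) (hs : Spr τ) {v : Vt} (hv : v.good) (hx : v.x ≠ 3)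
    (hy : v.y ≠ 3) : Loc M τ 1 (fun _ => shv C k mm v) v := by
  have hg : (shv C k mm v).good := Nd_shift _ _ _ _ hv
  constructor
  · norm_num
  · intro i _; exact hg
  · intro Y
    have : (∃ i, i < 1 ∧ M Y ∈ Kset τ (shv C k mm v)) ↔ M Y ∈ Kset τ (shv C k mm v) :=
      ⟨fun ⟨_, _, h⟩ => h, fun h => ⟨0, by norm_num, h⟩⟩
    rw [this]
    obtain ⟨h, x, y, z, w⟩ := v
    simp only [Vt.good] at hv hx hy
    have k3 := S.k3
    have ks := k_sum S hv
    have hr := kap_range S hv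
    constructor
    · rintro ⟨⟨h1, h3⟩, h4⟩
      obtain ⟨i1, l1, u1, m1⟩ := (S.sub _ _).1 h1
      obtain ⟨i3, l3, u3, m3⟩ := (S.sub _ _).1 h3
      obtain ⟨i4, l4, u4, m4⟩ := (S.sub _ _).1 h4
      simp only [S.mm_dl, up_add_dl, up_up] at m3 m4
      have m1' : M Y ∈ τ (up (mm h + dl (x+1) + dl (y+1) + dl (z+1) + dl (w+1)) i1) := by
        rwa [S.congr _ (up (mm h) i1) 1 (fun j => by
          have := Nd_sum (Nd_shift _ _ _ _ hv) j
          simp only [up, Pi.add_apply]; linarith)]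
      have c1 : i1 ≤ -k x + -k y + i3 := by
        have e := hs _ _ _ m1 m3 0 (x+1)
        have hne : x + 1 ≠ y + 1 := (Nd_shift _ _ _ _ hv).1
        have a1 := succ_ne_zero4 hx
        have a2 := succ_ne_zero4 hy
        simp [up, dl, a1, a2, a1.symm, a2.symm, hv.1] at e
        linarith
      have c3 : -k x + -k y + i3 ≤ -k x + -k y + -k z + i4 := by
        by_cases hx : z = 3
        · subst hx; omega
        · exact (step_le hs (succ_ne_zero4 hx) m3 m4).1
      have c4 : -k x + -k y + -k z + i4 ≤ i1 := by
        by_cases hx : w = 3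
        · subst hx; omega
        · exact (step_le hs (succ_ne_zero4 hx) m4 m1').1
      have ek : kap C k x y z = i1 := by
        unfold kap
        rw [if_neg hx, if_neg hy]
        split_ifs with c
        · subst c; omega
        · have : w = 3 := by
            rcases Nd_cover x y z w hv 3 with h | h | h | h
            · exact absurd h.symm hx
            · exact absurd h.symm hy
            · exact absurd h.symm c
            · exact h.symm
          subst this; omega
      have e3 : -k x + -k y + i3 = i1 := by omega
      have e4 : -k x + -k y + -k z + i4 = i1 := by omega
      rw [e3] at m3
      rw [e4] at m4
      simp only [Kset, shv, ek, up_add_dl]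
      exact ⟨⟨m1, m3⟩, m4⟩
    · intro hY
      simp only [Kset, shv, up_add_dl] at hY
      obtain ⟨⟨m1, m3⟩, m4⟩ := hY
      refine ⟨⟨(S.sub _ _).2 ⟨_, hr.1, hr.2.1, m1⟩,
        (S.sub _ _).2 ⟨_, hr.2.2.2.2.1, hr.2.2.2.2.2.1, ?_⟩⟩,
        (S.sub _ _).2 ⟨_, hr.2.2.2.2.2.2.1, hr.2.2.2.2.2.2.2, ?_⟩⟩
      · simp only [S.mm_dl, up_add_dl, up_up]
        rwa [show -k x + -k y + (kap C k x y z + k x + k y) = kap C k x y z by ring]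
      · simp only [S.mm_dl, up_add_dl, up_up]
        rwa [show -k x + -k y + -k z + (kap C k x y z + k x + k y + k z) = kap C k x y z by ring]
  · exact pt_eq S hs hg (IsV_shift S hs hv (pt_spec S hv))
  · have := IsV_shift S hs (Nd_swap hv) (pt_spec S (rv_good hv))
    rw [← shv_rv v hx hy]
    exact pt_eq S hs (v := shv C k mm (rv v)) (Nd_shift _ _ _ _ (Nd_swap hv)) this
  · intro i hi; omega
  · intro i j Y h1 h2; omega

/-- number of children -/
def nch (k : Fin 4 → ℤ) (v : Vt) : ℕ :=
  if v.x = 3 then 3 * (k v.y).toNat + 1 else if v.y = 3 then 3 * (k v.x).toNat + 1 else 1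

/-- children -/
def chl (C : ℤ) (k : Fin 4 → ℤ) (mm : Ht → Ht) (v : Vt) (i : ℕ) : Vt :=
  if v.x = 3 then rv (ich C k mm (rv v) ((nch k v - 1 - i : ℕ) : ℤ))
  else if v.y = 3 then ich C k mm v i else shv C k mm v

theorem Loc_all (S : Sys C k mm M N τ) (hs : Spr τ) {v : Vt} (hv : v.good) :
    Loc M τ (nch k v) (chl C k mm v) v := by
  by_cases hx : v.x = 3
  · obtain ⟨h, x, y, z, w⟩ := v
    simp only at hx
    subst hx
    have := Loc_rv (Loc_inc S hs (h := h) (Nd_swap hv))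
    unfold chl nch
    simp only [if_true]
    exact this
  · by_cases hy : v.y = 3
    · obtain ⟨h, x, y, z, w⟩ := v
      simp only at hx hy
      subst hy
      have := Loc_inc S hs (h := h) hv
      unfold chl nch
      simp only [if_true, hx, if_false]
      exact this
    · unfold chl nch
      simp only [hx, hy, if_false]
      exact Loc_shift S hs hv hx hy

def rk (v : Vt) : ℕ :=
  if v.x = 3 ∨ v.y = 3 then (if v.x = 0 ∨ v.y = 0 then 3 else 0)
  else if v.x = 2 ∨ v.y = 2 then 1 else 2

theorem rk_drop (S : Sys C k mm M N τ) (hs : Spr τ) (v : Vt) (hv : v.good) (h1 : nch k v = 1) :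
    rk (chl C k mm v 0) < rk v := by
  have k1 := k1_pos S hs
  have k2 := S.k2
  have key : ∀ y : Fin 4, y ≠ 3 → (k y).toNat = 0 → y = 0 := by
    intro y hy h
    fin_cases y
    · rfl
    · simp at h; omega
    · simp at h; omega
    · exact absurd rfl hy
  obtain ⟨h, x, y, z, w⟩ := v
  by_cases hx : x = 3
  · subst hx
    simp [nch] at h1
    have := key y hv.1.symm (by omega)
    subst this
    simp [chl, nch, h1, rk, rv, ich, ach, ct]
  · by_cases hy : y = 3
    · subst hy
      simp [nch, hx] at h1
      have := key x hv.1 (by omega)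
      subst this
      simp [chl, rk, ich, ach, ct]
    · simp only [chl, hx, hy, if_false, shv, rk]
      have hxy := hv.1
      simp only at hxy
      have key2 : ∀ x y : Fin 4, ¬ x = 3 → ¬ y = 3 → x ≠ y →
          (if x + 1 = 3 ∨ y + 1 = 3 then if x + 1 = 0 ∨ y + 1 = 0 then 3 else 0
            else if x + 1 = 2 ∨ y + 1 = 2 then 1 else 2) <
            if False ∨ False then if x = 0 ∨ y = 0 then 3 else 0
            else if x = 2 ∨ y = 2 then 1 else 2 := by decide
      exact key2 x y hx hy hxy

theorem arcs_chain (S : Sys C k mm M N τ) (hs : Spr τ) :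
    ChainSys Vt.good (nch k) (chl C k mm) (Kset τ) (fun _ _ => N) (pt τ) (fun v => pt τ (rv v)) := by
  have hp : ∀ v : Vt, v.good → pt τ v ∈ Kset τ v := fun v hv =>
    have := pt_spec S hv
    ⟨⟨this.1, this.2.2.1⟩, this.2.2.2⟩
  constructor
  · exact fun v hv => (Loc_all S hs hv).npos
  · exact fun v i hv hi => (Loc_all S hs hv).gch i hi
  · intro v hv
    exact ((S.cpt _).inter (S.cpt _)).inter (S.cpt _)
  · exact hp
  · intro v hv
    rw [← Kset_rv]
    exact hp _ (rv_good hv)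
  · exact fun _ _ => S.Ncont
  · intro _ _ _ x y hxy
    rw [← S.MN x, ← S.MN y]
    exact congrArg M hxy
  · intro v Y hv
    rw [(Loc_all S hs hv).cover]
    constructor
    · rintro ⟨i, hi, h⟩
      exact ⟨i, hi, _, h, S.NM _⟩
    · rintro ⟨i, hi, Z, h, rfl⟩
      exact ⟨i, hi, by rwa [S.MN]⟩
  · intro v hv
    rw [← (Loc_all S hs hv).pfirst, S.NM]
  · intro v hv
    rw [← (Loc_all S hs hv).qlast, S.NM]
  · intro v i hv hi
    rw [(Loc_all S hs hv).glue i hi]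
  · intro v i j Y Y' hv hij hj h1 h2 h
    have e : Y = Y' := by
      rw [← S.MN Y, ← S.MN Y']
      exact congrArg M h
    subst e
    obtain ⟨a, b⟩ := (Loc_all S hs hv).overlap i j Y hij hj h1 h2
    refine ⟨a, b, ?_⟩
    subst a
    rw [← (Loc_all S hs hv).glue i hj]
    exact b
  · intro v hv he
    have h1 := (pt_spec S hv).2.1
    have h2 := (pt_spec S (rv_good hv)).2.1
    rw [← he] at h2
    have := hs _ _ _ h1 h2 v.x v.y
    have hxy : v.x ≠ v.y := hv.1
    simp [rv, dl, hxy, hxy.symm] at this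
  · intro v x y hv H
    refine S.uniq _ _ fun n => ?_
    have key : ∀ m v x y, SameCyl (nch k) (chl C k mm) (Kset τ) (fun _ _ => N) m v x y →
        ∃ g, M^[m] x ∈ τ g ∧ M^[m] y ∈ τ g := by
      intro m
      induction m with
      | zero =>
        rintro v x y ⟨h1, h2⟩
        exact ⟨v.h, h1.1.1, h2.1.1⟩
      | succ m ih =>
        rintro v x y ⟨i, hi, x', y', rfl, rfl, h⟩
        simp only [Function.iterate_succ_apply, S.MN]
        exact ih _ _ _ h
    obtain ⟨g, h1, h2⟩ := key n v x y (H n)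
    exact ⟨g, g, by simp, h1, h2⟩

theorem Kset_arc (S : Sys C k mm M N τ) (hs : Spr τ) {v : Vt} (hv : v.good) :
    Nonempty (Kset τ v ≃ₜ Set.Icc (0:ℝ) 1) := by
  have h1 := arcs_chain S hs
  have h2 := interval_chain (good := Vt.good) (n := nch k) (ch := chl C k mm) rk h1.npos h1.gch
    (by intro v; unfold rk; split_ifs <;> norm_num) (rk_drop S hs)
  exact chain_homeo h1 h2 v hv

end arcs

/-- subset indicator -/
def ind (U : Finset (Fin 4)) : Ht := fun j => if j ∈ U then 1 else 0

set_option maxRecDepth 100000 in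
theorem card_P : (Finset.univ.filter fun U : Finset (Fin 4) => U ≠ ∅ ∧ U ≠ Finset.univ).card = 14 := by
  decide

set_option maxRecDepth 100000 in
theorem card_Q : (Finset.univ.filter fun p : Finset (Fin 4) × Finset (Fin 4) =>
    p.1 ≠ ∅ ∧ p.1 ⊂ p.2 ∧ p.2 ≠ Finset.univ).card = 36 := by
  decide

set_option maxRecDepth 100000 in
theorem split1 : ∀ U : Finset (Fin 4), U ≠ ∅ → U ≠ Finset.univ → ∃ x y z w, Nd x y z w ∧
    (U = {x} ∨ U = {x, y} ∨ U = {x, y, z}) := by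
  decide

set_option maxRecDepth 100000 in
theorem split2 : ∀ U V : Finset (Fin 4), U ≠ ∅ → U ⊂ V → V ≠ Finset.univ → ∃ x y z w, Nd x y z w ∧
    (U = {x, y} ∧ V = {x, y, z} ∨ U = {x} ∧ V = {x, y, z} ∨ U = {x} ∧ V = {x, y}) := by
  decide

theorem ind_insert {x : Fin 4} {U : Finset (Fin 4)} (h : x ∉ U) : ind (insert x U) = dl x + ind U := by
  funext j
  by_cases hj : j = x
  · subst hj; simp [ind, dl, h]
  · simp [ind, dl, hj]

theorem ind_one (x : Fin 4) : ind {x} = dl x := by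
  funext j; simp [ind, dl]

theorem ind_two {x y : Fin 4} (h : x ≠ y) : ind {x, y} = dl x + dl y := by
  rw [ind_insert (by simpa using h), ind_one]

theorem ind_three {x y z : Fin 4} (h : x ≠ y) (h2 : x ≠ z) (h3 : y ≠ z) :
    ind {x, y, z} = dl x + dl y + dl z := by
  rw [ind_insert (by simp [h, h2]), ind_two h3, add_assoc]

def eZ (A B : ℤ) (h : Ht) : Fin 3 → ℤ :=
  ![h 0 + (A-1) * h 1 + (B-A) * h 2 - B * h 3, h 1 + (A-1) * h 2 - A * h 3, h 2 - h 3]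

def kk (A B C : ℤ) : Fin 4 → ℤ := ![A-1, B-A, C-B, 1-C]

def mmz (A B C : ℤ) (h : Ht) : Ht :=
  ![h 3 - ((A-1) * h 0 + (B-A) * h 1 + (C-B) * h 2 + (1-C) * h 3), h 0, h 1, h 2]

def ta (A B : ℤ) (T : Set (Fin 3 → ℝ)) (h : Ht) : Set (Fin 3 → ℝ) := {x | x - toR (eZ A B h) ∈ T}

theorem eZ_sub (A B : ℤ) (h h' : Ht) : eZ A B (h - h') = eZ A B h - eZ A B h' := by
  funext i; fin_cases i <;> simp [eZ] <;> ring

theorem eZ_ker (A B : ℤ) (h : Ht) (H : eZ A B h = 0) (j : Fin 4) : h j = h 3 := by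
  have e0 := congrFun H 0
  have e1 := congrFun H 1
  have e2 := congrFun H 2
  simp [eZ] at e0 e1 e2
  have f2 : h 2 = h 3 := by linarith
  rw [f2] at e0 e1
  have f1 : h 1 = h 3 := by linarith
  rw [f1] at e0
  have f0 : h 0 = h 3 := by linarith
  fin_cases j
  · exact f0
  · exact f1
  · exact f2
  · rfl

theorem eZ_congr (A B : ℤ) (h h' : Ht) (c : ℤ) (H : ∀ j, h j = h' j + c) : eZ A B h = eZ A B h' := by
  funext i; fin_cases i <;> simp [eZ, H] <;> ring

theorem toR_sub (a b : Fin 3 → ℤ) : toR (a - b) = toR a - toR b := by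
  funext i; simp [toR]

theorem mem_tr (v : Fin 3 → ℝ) (T : Set (Fin 3 → ℝ)) (x : Fin 3 → ℝ) :
    x ∈ tileTranslate v T ↔ x - v ∈ T := by
  constructor
  · rintro ⟨y, hy, rfl⟩
    simpa using hy
  · intro h
    exact ⟨_, h, by simp⟩

theorem Mf_eZ (A B C : ℤ) (h : Ht) (i : ℤ) :
    Mf A B C (toR (eZ A B h)) + ![(i:ℝ), 0, 0] = toR (eZ A B (up (mmz A B C h) i)) := by
  funext j; fin_cases j <;> simp [Mf, eZ, toR, up, mmz] <;> ring

theorem sys_of_tile {A B C : ℤ} {T : Set (Fin 3 → ℝ)} (hT : IsABCTile A B C T) :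
    Sys C (kk A B C) (mmz A B C) (Mf A B C) (Nf A B C) (ta A B T) := by
  obtain ⟨hA, hB, hC, hne, hcpt, -, hset⟩ := hT
  have hC0 : (C:ℝ) ≠ 0 := by exact_mod_cast (by omega : C ≠ 0)
  constructor
  · exact Mf_Nf hC0
  · exact Nf_Mf hC0
  · exact Nf_cont A B C
  · intro h x
    funext j
    fin_cases x <;> fin_cases j <;> simp [mmz, up, dl, kk] <;> ring
  · intro h x
    have e : x ∈ ta A B T h ↔ Mf A B C (x - toR (eZ A B h)) ∈ (Mmat A B C).mulVec '' T := by
      constructor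
      · intro hx
        exact ⟨_, hx, Mf_eq A B C _⟩
      · rintro ⟨y, hy, hxy⟩
        rw [Mf_eq] at hxy
        have := congrArg (Nf A B C) hxy
        rw [Nf_Mf hC0, Nf_Mf hC0] at this
        rw [this] at hy
        exact hy
    rw [e, hset]
    simp only [Set.mem_iUnion, Ddig, Set.mem_setOf_eq, exists_prop, mem_tr]
    constructor
    · rintro ⟨d, ⟨i, i0, i1, rfl⟩, hd⟩
      refine ⟨i, i0, i1, ?_⟩
      rw [Mf_sub, sub_sub, Mf_eZ] at hd
      exact hd
    · rintro ⟨i, i0, i1, hd⟩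
      refine ⟨_, ⟨i, i0, i1, rfl⟩, ?_⟩
      rw [Mf_sub, sub_sub, Mf_eZ]
      exact hd
  · intro h h' c H
    simp only [ta, eZ_congr A B h h' c H]
  · intro h
    have : ta A B T h = (fun x => x + toR (eZ A B h)) '' T := by
      ext x
      exact (mem_tr _ _ _).symm
    rw [this]
    exact hcpt.image (by fun_prop)
  · intro h
    obtain ⟨x, hx⟩ := hne
    exact ⟨x + toR (eZ A B h), by simpa [ta] using hx⟩
  · intro x y H
    obtain ⟨R, hR⟩ := hcpt.isBounded.exists_norm_le
    have hR' : ∀ x ∈ T, ∀ i, |x i| ≤ R := fun x hx i => (norm_le_pi_norm x i).trans (hR x hx)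
    have key : x - y = 0 := by
      refine Mf_bounded hA hB hC _ (R + R + 2 * B) ?_
      intro n i
      rw [Mf_iter_sub]
      obtain ⟨h, h', hh, h1, h2⟩ := H n
      have b1 := hR' _ h1 i
      have b2 := hR' _ h2 i
      have b3 : |eZ A B h i - eZ A B h' i| ≤ 2 * B := by
        have a0 := abs_le.1 (hh 0)
        have a1 := abs_le.1 (hh 1)
        have a2 := abs_le.1 (hh 2)
        have a3 := abs_le.1 (hh 3)
        rw [abs_le]
        fin_cases i <;> simp [eZ] <;> constructor <;> nlinarith
      have b3' : |(eZ A B h i : ℝ) - eZ A B h' i| ≤ 2 * B := by exact_mod_cast b3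
      simp only [Pi.sub_apply, toR] at b1 b2 ⊢
      rw [abs_le] at *
      constructor <;> linarith
    exact sub_eq_zero.1 key
  · rfl
  · simp [kk]; omega
  · simp [kk]; omega
  · simp [kk]; omega
  · simp [kk]

theorem ind_inj {A B : ℤ} {U V : Finset (Fin 4)} (hU : U ≠ Finset.univ) (hV : V ≠ Finset.univ)
    (h : eZ A B (ind U) = eZ A B (ind V)) : U = V := by
  have h0 : eZ A B (ind U - ind V) = 0 := by rw [eZ_sub, h, sub_self]
  have hk := eZ_ker A B _ h0
  obtain ⟨p, hp⟩ : ∃ p, p ∉ U := by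
    by_contra hcon; push Not at hcon
    exact hU (Finset.eq_univ_of_forall hcon)
  obtain ⟨q, hq⟩ : ∃ q, q ∉ V := by
    by_contra hcon; push Not at hcon
    exact hV (Finset.eq_univ_of_forall hcon)
  have e1 := hk p
  have e2 := hk q
  simp only [Pi.sub_apply] at hk e1 e2
  have hc : ind U 3 - ind V 3 = 0 := by
    have f1 : ind U p = 0 := by simp [ind, hp]
    have f2 : ind V q = 0 := by simp [ind, hq]
    have f3 : 0 ≤ ind V p := by unfold ind; split_ifs <;> norm_num
    have f4 : 0 ≤ ind U q := by unfold ind; split_ifs <;> norm_num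
    linarith
  ext j
  have := hk j
  rw [hc] at this
  simp only [ind] at this
  split_ifs at this <;> simp_all

theorem pairs_arc {C : ℤ} {k : Fin 4 → ℤ} {mm : Ht → Ht} {M N : (Fin 3 → ℝ) → (Fin 3 → ℝ)}
    {τ : Ht → Set (Fin 3 → ℝ)} (S : Sys C k mm M N τ) (hs : Spr τ) {U V : Finset (Fin 4)}
    (hU : U ≠ ∅) (hUV : U ⊂ V) (hV : V ≠ Finset.univ) :
    Nonempty ((τ 0 ∩ τ (ind U) ∩ τ (ind V) : Set (Fin 3 → ℝ)) ≃ₜ Set.Icc (0:ℝ) 1) := by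
  obtain ⟨x, y, z, w, hn, H⟩ := split2 U V hU hUV hV
  have hsum := Nd_sum hn
  obtain ⟨h1, h2, h3, h4, h5, h6⟩ := id hn
  rcases H with ⟨rfl, rfl⟩ | ⟨rfl, rfl⟩ | ⟨rfl, rfl⟩
  · have := Kset_arc S hs (v := ⟨0, x, y, z, w⟩) hn
    have e0 : (0 : Ht) + dl x = dl x := zero_add _
    have e : Kset τ ⟨0, x, y, z, w⟩ = τ 0 ∩ τ (ind {x, y}) ∩ τ (ind {x, y, z}) := by
      rw [ind_two h1, ind_three h1 h2 h4]
      simp only [Kset, e0]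
    rwa [e] at this
  · have hg : Nd y z w x := ⟨h4, h5, h1.symm, h6, h2.symm, h3.symm⟩
    have := Kset_arc S hs (v := ⟨dl x, y, z, w, x⟩) hg
    have e : Kset τ ⟨dl x, y, z, w, x⟩ = τ 0 ∩ τ (ind {x}) ∩ τ (ind {x, y, z}) := by
      rw [ind_one, ind_three h1 h2 h4]
      simp only [Kset]
      rw [S.congr (dl x + dl y + dl z + dl w) 0 1 (fun j => by
        simpa using hsum j)]
      ext Y
      simp only [Set.mem_inter_iff]
      tauto
    rwa [e] at this
  · have hg : Nd z w x y := ⟨h6, h2.symm, h4.symm, h3.symm, h5.symm, h1⟩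
    have := Kset_arc S hs (v := ⟨dl x + dl y, z, w, x, y⟩) hg
    have e : Kset τ ⟨dl x + dl y, z, w, x, y⟩ = τ 0 ∩ τ (ind {x}) ∩ τ (ind {x, y}) := by
      rw [ind_one, ind_two h1]
      simp only [Kset]
      rw [S.congr (dl x + dl y + dl z + dl w) 0 1 (fun j => by
        simpa using hsum j), S.congr (dl x + dl y + dl z + dl w + dl x) (dl x) 1 (fun j => by
        have := hsum j
        simp only [Pi.add_apply]; linarith)]
      ext Y
      simp only [Set.mem_inter_iff]
      tauto
    rwa [e] at this

theorem ind_nbr {C : ℤ} {k : Fin 4 → ℤ} {mm : Ht → Ht} {M N : (Fin 3 → ℝ) → (Fin 3 → ℝ)}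
    {τ : Ht → Set (Fin 3 → ℝ)} (S : Sys C k mm M N τ) {U : Finset (Fin 4)}
    (hU : U ≠ ∅) (hV : U ≠ Finset.univ) : (τ 0 ∩ τ (ind U)).Nonempty := by
  obtain ⟨x, y, z, w, hn, H⟩ := split1 U hU hV
  obtain ⟨Y, a1, a2, a3, a4⟩ := IsV_exists S ⟨0, x, y, z, w⟩ hn
  simp only [zero_add] at a1 a2 a3 a4
  obtain ⟨h1, h2, h3, h4, h5, h6⟩ := id hn
  rcases H with rfl | rfl | rfl
  · exact ⟨Y, a1, by rwa [ind_one]⟩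
  · exact ⟨Y, a1, by rwa [ind_two h1]⟩
  · exact ⟨Y, a1, by rwa [ind_three h1 h2 h4]⟩

theorem ta_zero (A B : ℤ) (T : Set (Fin 3 → ℝ)) : ta A B T 0 = T := by
  have : toR (eZ A B 0) = 0 := by funext i; fin_cases i <;> simp [toR, eZ]
  simp [ta, this]

theorem ta_tr (A B : ℤ) (T : Set (Fin 3 → ℝ)) (h : Ht) :
    tileTranslate (toR (eZ A B h)) T = ta A B T h := by
  ext x; exact mem_tr _ _ _

theorem nbr_eq {A B C : ℤ} {T : Set (Fin 3 → ℝ)} (hT : IsABCTile A B C T)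
    (h14 : (Neighbors T).ncard = 14) :
    (fun U => eZ A B (ind U)) '' ((Finset.univ.filter
      fun U : Finset (Fin 4) => U ≠ ∅ ∧ U ≠ Finset.univ : Finset _) : Set (Finset (Fin 4))) =
      Neighbors T := by
  have S := sys_of_tile hT
  have hinj : Set.InjOn (fun U => eZ A B (ind U)) ((Finset.univ.filter
      fun U : Finset (Fin 4) => U ≠ ∅ ∧ U ≠ Finset.univ : Finset _) : Set (Finset (Fin 4))) := by
    intro U hU V hV h
    simp only [Finset.coe_filter, Finset.mem_univ, true_and, Set.mem_setOf_eq] at hU hV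
    exact ind_inj hU.2 hV.2 h
  refine Set.eq_of_subset_of_ncard_le ?_ ?_ ?_
  · rintro _ ⟨U, hU, rfl⟩
    simp only [Finset.coe_filter, Finset.mem_univ, true_and, Set.mem_setOf_eq] at hU
    refine ⟨?_, ?_⟩
    · intro h0
      have e0 : eZ A B (ind ∅) = 0 := by funext i; fin_cases i <;> simp [eZ, ind]
      exact hU.1 (ind_inj hU.2 (by decide) (h0.trans e0.symm))
    · have := ind_nbr S hU.1 hU.2
      rwa [ta_zero, ← ta_tr] at this
  · rw [h14, Set.ncard_image_of_injOn hinj, Set.ncard_coe_finset, card_P]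
  · exact Set.finite_of_ncard_ne_zero (by omega)

theorem spr_of_tile {A B C : ℤ} {T : Set (Fin 3 → ℝ)} (hT : IsABCTile A B C T)
    (h14 : (Neighbors T).ncard = 14) : Spr (ta A B T) := by
  intro h h' x h1 h2 p q
  have hN := nbr_eq hT h14
  have : ∃ U : Finset (Fin 4), eZ A B (h' - h) = eZ A B (ind U) := by
    by_cases h0 : eZ A B (h' - h) = 0
    · exact ⟨∅, by rw [h0]; funext i; fin_cases i <;> simp [eZ, ind]⟩
    · have : eZ A B (h' - h) ∈ Neighbors T := by
        refine ⟨h0, x - toR (eZ A B h), h1, ?_⟩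
        rw [mem_tr, eZ_sub, toR_sub]
        have e : x - toR (eZ A B h) - (toR (eZ A B h') - toR (eZ A B h)) =
          x - toR (eZ A B h') := by abel
        rw [e]
        exact h2
      rw [← hN] at this
      obtain ⟨U, -, hU⟩ := this
      exact ⟨U, hU.symm⟩
  obtain ⟨U, hU⟩ := this
  have hk := eZ_ker A B (h' - h - ind U) (by rw [eZ_sub, hU, sub_self])
  have e1 := hk p
  have e2 := hk q
  have : ind U q - ind U p ≤ 1 := by
    simp only [ind]; split_ifs <;> norm_num
  simp only [Pi.sub_apply] at e1 e2
  linarith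

theorem chain_of_mem {τ : Ht → Set (Fin 3 → ℝ)} (hs : Spr τ) {U V : Finset (Fin 4)} {x : Fin 3 → ℝ}
    (h1 : x ∈ τ (ind U)) (h2 : x ∈ τ (ind V)) (hne : U ≠ V) : U ⊂ V ∨ V ⊂ U := by
  by_contra hcon
  push Not at hcon
  have a : ¬ U ⊆ V := fun h => hcon.1 (lt_of_le_of_ne h hne)
  have b : ¬ V ⊆ U := fun h => hcon.2 (lt_of_le_of_ne h hne.symm)
  obtain ⟨p, p1, p2⟩ := Finset.not_subset.1 a
  obtain ⟨q, q1, q2⟩ := Finset.not_subset.1 b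
  have := hs _ _ _ h1 h2 p q
  simp [ind, p1, p2, q1, q2] at this

theorem stmt6 (A B C : ℤ) (T : Set (Fin 3 → ℝ)) (hT : IsABCTile A B C T)
    (h14 : (Neighbors T).ncard = 14) :
    (∀ α β : Fin 3 → ℤ, α ≠ 0 → β ≠ 0 → α ≠ β →
      T ∩ tileTranslate (toR α) T ∩ tileTranslate (toR β) T = ∅ ∨
      Nonempty ((T ∩ tileTranslate (toR α) T ∩ tileTranslate (toR β) T : Set (Fin 3 → ℝ)) ≃ₜ
        Set.Icc (0 : ℝ) 1)) ∧
    {s : Set (Fin 3 → ℤ) | ∃ α β : Fin 3 → ℤ, α ≠ 0 ∧ β ≠ 0 ∧ α ≠ β ∧ s = {α, β} ∧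
      (T ∩ tileTranslate (toR α) T ∩ tileTranslate (toR β) T).Nonempty}.ncard = 36 := by
  have S := sys_of_tile hT
  have hs := spr_of_tile hT h14
  have hN := nbr_eq hT h14
  have key : ∀ α β : Fin 3 → ℤ, α ≠ 0 → β ≠ 0 → α ≠ β →
      (T ∩ tileTranslate (toR α) T ∩ tileTranslate (toR β) T).Nonempty →
      ∃ U V : Finset (Fin 4), U ≠ ∅ ∧ U ⊂ V ∧ V ≠ Finset.univ ∧
        (α = eZ A B (ind U) ∧ β = eZ A B (ind V) ∨ β = eZ A B (ind U) ∧ α = eZ A B (ind V)) := by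
    rintro α β ha hb hab ⟨x, ⟨x0, x1⟩, x2⟩
    have mα : α ∈ Neighbors T := ⟨ha, x, x0, x1⟩
    have mβ : β ∈ Neighbors T := ⟨hb, x, x0, x2⟩
    rw [← hN] at mα mβ
    obtain ⟨U, hU, rfl⟩ := mα
    obtain ⟨V, hV, rfl⟩ := mβ
    simp only [Finset.coe_filter, Finset.mem_univ, true_and, Set.mem_setOf_eq] at hU hV
    rw [ta_tr] at x1 x2
    rcases chain_of_mem hs x1 x2 (fun h => hab (by rw [h])) with h | h
    · exact ⟨U, V, hU.1, h, hV.2, Or.inl ⟨rfl, rfl⟩⟩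
    · exact ⟨V, U, hV.1, h, hU.2, Or.inr ⟨rfl, rfl⟩⟩
  have arc : ∀ U V : Finset (Fin 4), U ≠ ∅ → U ⊂ V → V ≠ Finset.univ →
      Nonempty ((T ∩ tileTranslate (toR (eZ A B (ind U))) T ∩
        tileTranslate (toR (eZ A B (ind V))) T : Set (Fin 3 → ℝ)) ≃ₜ Set.Icc (0:ℝ) 1) := by
    intro U V hU hUV hV
    have := pairs_arc S hs hU hUV hV
    rwa [ta_zero, ← ta_tr, ← ta_tr] at this
  constructor
  · intro α β ha hb hab
    rcases Set.eq_empty_or_nonempty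
      (T ∩ tileTranslate (toR α) T ∩ tileTranslate (toR β) T) with he | he
    · exact Or.inl he
    · right
      obtain ⟨U, V, hU, hUV, hV, ⟨rfl, rfl⟩ | ⟨rfl, rfl⟩⟩ := key α β ha hb hab he
      · exact arc U V hU hUV hV
      · rw [Set.inter_right_comm]
        exact arc U V hU hUV hV
  · have hset : {s : Set (Fin 3 → ℤ) | ∃ α β : Fin 3 → ℤ, α ≠ 0 ∧ β ≠ 0 ∧ α ≠ β ∧ s = {α, β} ∧
        (T ∩ tileTranslate (toR α) T ∩ tileTranslate (toR β) T).Nonempty} =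
        (fun p : Finset (Fin 4) × Finset (Fin 4) =>
          ({eZ A B (ind p.1), eZ A B (ind p.2)} : Set (Fin 3 → ℤ))) ''
        ((Finset.univ.filter fun p : Finset (Fin 4) × Finset (Fin 4) =>
          p.1 ≠ ∅ ∧ p.1 ⊂ p.2 ∧ p.2 ≠ Finset.univ : Finset _) :
            Set (Finset (Fin 4) × Finset (Fin 4))) := by
      ext s
      simp only [Set.mem_setOf_eq, Set.mem_image, Finset.coe_filter, Finset.mem_univ, true_and,
        Prod.exists]
      constructor
      · rintro ⟨α, β, ha, hb, hab, rfl, he⟩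
        obtain ⟨U, V, hU, hUV, hV, ⟨rfl, rfl⟩ | ⟨rfl, rfl⟩⟩ := key α β ha hb hab he
        · exact ⟨U, V, ⟨hU, hUV, hV⟩, rfl⟩
        · exact ⟨U, V, ⟨hU, hUV, hV⟩, Set.pair_comm _ _⟩
      · rintro ⟨U, V, ⟨hU, hUV, hV⟩, rfl⟩
        have hU' : U ≠ Finset.univ := fun h => hUV.2 (h ▸ Finset.subset_univ V)
        have hV' : V ≠ ∅ := fun h => hUV.2 (h ▸ Finset.empty_subset U)
        have mU : eZ A B (ind U) ∈ Neighbors T := by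
          rw [← hN]
          exact ⟨U, by simp [hU, hU'], rfl⟩
        have mV : eZ A B (ind V) ∈ Neighbors T := by
          rw [← hN]
          exact ⟨V, by simp [hV, hV'], rfl⟩
        refine ⟨_, _, mU.1, mV.1, fun h => ?_, rfl, ?_⟩
        · exact hUV.ne (ind_inj hU' hV h)
        · obtain ⟨f⟩ := arc U V hU hUV hV
          exact ⟨_, (f.symm ⟨0, by simp⟩).2⟩
    rw [hset, Set.ncard_image_of_injOn, Set.ncard_coe_finset, card_Q]
    rintro ⟨U, V⟩ h1 ⟨U', V'⟩ h2 h
    simp only [Finset.coe_filter, Finset.mem_univ, true_and, Set.mem_setOf_eq] at h1 h2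
    have hU : U ≠ Finset.univ := fun h => h1.2.1.2 (h ▸ Finset.subset_univ V)
    have hU' : U' ≠ Finset.univ := fun h => h2.2.1.2 (h ▸ Finset.subset_univ V')
    rcases Set.pair_eq_pair_iff.1 h with ⟨a, b⟩ | ⟨a, b⟩
    · rw [ind_inj hU hU' a, ind_inj h1.2.2 h2.2.2 b]
    · have e1 := ind_inj hU h2.2.2 a
      have e2 := ind_inj h1.2.2 hU' b
      subst e1 e2
      exact absurd h2.2.1 (fun h => h1.2.1.2 h.1)
end

section
/- Let T be an ABC-tile having exactly 14 neighbors. Then for any four pairwise distinct α₁, α₂, α₃, α₄ ∈ ℤ³ \ {0}, the 5-fold intersection T ∩ (T + α₁) ∩ (T + α₂) ∩ (T + α₃) ∩ (T + α₄) is empty. Consequently, every (ℓ+1)-fold intersection of T with ℓ ≥ 4 distinct nonzero lattice translates of T is empty. -/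
open MeasureTheory

/-- Contraction over six steps for the backward recurrence. -/
lemma rec_step (A B C : ℝ) (hA : 1 ≤ A) (hAB : A ≤ B) (hBC : B + 1 ≤ C) (K : ℝ) (hK : 0 ≤ K)
    (q : ℕ → ℝ) (hq : ∀ n, q n + A * q (n+1) + B * q (n+2) + C * q (n+3) = 0)
    (h0 : q 0 ≤ K) (h1 : q 1 ≤ K) (h2 : q 2 ≤ K) (h3 : q 3 ≤ K) (i : ℕ) (hi : i < 4) :
    q (6 + i) ≤ (1 - (1 / C) ^ 6) * K := by
  have hC : 0 < C := by linarith
  have hr0 : 0 < 1 / C := by positivity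
  have hr1 : 1 / C ≤ 1 := by rw [div_le_one hC]; linarith
  set r := 1 / C with hr
  have hrC : r * C = 1 := by rw [hr]; field_simp
  have four : ∀ n, C * q (n+4) = (C - B) * q (n+3) + (B - A) * q (n+2) + (A - 1) * q (n+1)
      + q n := by
    intro n
    have e1 := hq n
    have e2 : q (n+1) + A * q (n+2) + B * q (n+3) + C * q (n+4) = 0 := hq (n+1)
    linarith
  have step : ∀ n, q n ≤ K → q (n+1) ≤ K → q (n+2) ≤ K → q (n+3) ≤ K →
      q (n+4) ≤ K ∧ r * (K - q n) ≤ K - q (n+4) ∧ r * (K - q (n+3)) ≤ K - q (n+4) := by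
    intro n a0 a1 a2 a3
    have f := four n
    have m1 : 0 ≤ (C - B - 1) * (K - q (n+3)) := mul_nonneg (by linarith) (by linarith)
    have m2 : 0 ≤ (B - A) * (K - q (n+2)) := mul_nonneg (by linarith) (by linarith)
    have m3 : 0 ≤ (A - 1) * (K - q (n+1)) := mul_nonneg (by linarith) (by linarith)
    have b1 : K - q n ≤ C * (K - q (n+4)) := by linarith
    have b2 : K - q (n+3) ≤ C * (K - q (n+4)) := by linarith
    have c1 := mul_le_mul_of_nonneg_left b1 hr0.le
    have c2 := mul_le_mul_of_nonneg_left b2 hr0.le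
    rw [← mul_assoc, hrC, one_mul] at c1 c2
    refine ⟨?_, c1, c2⟩
    have : 0 ≤ r * (K - q n) := mul_nonneg hr0.le (by linarith)
    linarith
  have all : ∀ n, q n ≤ K ∧ q (n+1) ≤ K ∧ q (n+2) ≤ K ∧ q (n+3) ≤ K := by
    intro n
    induction n with
    | zero => exact ⟨h0, h1, h2, h3⟩
    | succ n ih =>
      obtain ⟨a0, a1, a2, a3⟩ := ih
      exact ⟨a1, a2, a3, (step n a0 a1 a2 a3).1⟩
  have s4 : ∀ n, r * (K - q n) ≤ K - q (n+4) := fun n =>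
    (step n (all n).1 (all n).2.1 (all n).2.2.1 (all n).2.2.2).2.1
  have s1 : ∀ n, 3 ≤ n → r * (K - q n) ≤ K - q (n+1) := by
    intro n hn
    obtain ⟨m, rfl⟩ := Nat.exists_eq_add_of_le' hn
    exact (step m (all m).1 (all m).2.1 (all m).2.2.1 (all m).2.2.2).2.2
  have grow : ∀ n m : ℕ, ∀ j : ℕ, r ^ j * K ≤ K - q n → r * (K - q n) ≤ K - q m →
      r ^ (j+1) * K ≤ K - q m := by
    intro n m j h h'
    have := mul_le_mul_of_nonneg_left h hr0.le
    rw [pow_succ]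
    linarith
  have weaken : ∀ n j : ℕ, ∀ k, j ≤ k → r ^ j * K ≤ K - q n → r ^ k * K ≤ K - q n := by
    intro n j k hjk h
    have := pow_le_pow_of_le_one hr0.le hr1 hjk
    have := mul_le_mul_of_nonneg_right this hK
    linarith
  have e6 : r ^ 3 * K ≤ K - q 6 := by
    have key : q 0 ≤ 0 ∨ q 1 ≤ 0 ∨ q 2 ≤ 0 ∨ q 3 ≤ 0 := by
      by_contra! hcon
      obtain ⟨p0, p1, p2, p3⟩ := hcon
      have := hq 0
      have : 0 < A * q 1 := mul_pos (by linarith) p1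
      have : 0 < B * q 2 := mul_pos (by linarith) p2
      have : 0 < C * q 3 := mul_pos (by linarith) p3
      simp only [zero_add] at *
      linarith
    have z : ∀ n, q n ≤ 0 → r ^ 0 * K ≤ K - q n := by
      intro n h; simp; linarith
    rcases key with h | h | h | h
    · have a := grow 0 4 0 (z 0 h) (s4 0)
      have b := grow 4 5 1 a (s1 4 (by norm_num))
      exact grow 5 6 2 b (s1 5 (by norm_num))
    · have a := grow 1 5 0 (z 1 h) (s4 1)
      have b := grow 5 6 1 a (s1 5 (by norm_num))
      exact weaken 6 2 3 (by norm_num) b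
    · have a := grow 2 6 0 (z 2 h) (s4 2)
      exact weaken 6 1 3 (by norm_num) a
    · have a := grow 3 4 0 (z 3 h) (s1 3 (by norm_num))
      have b := grow 4 5 1 a (s1 4 (by norm_num))
      exact grow 5 6 2 b (s1 5 (by norm_num))
  have e7 := grow 6 7 3 e6 (s1 6 (by norm_num))
  have e8 := grow 7 8 4 e7 (s1 7 (by norm_num))
  have e9 := grow 8 9 5 e8 (s1 8 (by norm_num))
  have e6' := weaken 6 3 6 (by norm_num) e6
  have e7' := weaken 7 4 6 (by norm_num) e7
  have e8' := weaken 8 5 6 (by norm_num) e8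
  interval_cases i <;> norm_num at * <;> linarith

lemma rec_abs (A B C : ℝ) (hA : 1 ≤ A) (hAB : A ≤ B) (hBC : B + 1 ≤ C) (K : ℝ) (hK : 0 ≤ K)
    (q : ℕ → ℝ) (hq : ∀ n, q n + A * q (n+1) + B * q (n+2) + C * q (n+3) = 0)
    (h : ∀ i < 4, |q i| ≤ K) (m : ℕ) :
    ∀ i < 4, |q (6 * m + i)| ≤ (1 - (1 / C) ^ 6) ^ m * K := by
  have hC : 0 < C := by linarith
  have hr0 : 0 < 1 / C := by positivity
  have hr1 : 1 / C ≤ 1 := by rw [div_le_one hC]; linarith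
  have hl : 0 ≤ 1 - (1 / C) ^ 6 := by
    have := pow_le_one₀ (n := 6) hr0.le hr1
    linarith
  induction m with
  | zero => simpa using h
  | succ m ih =>
    intro i hi
    have hK' : 0 ≤ (1 - (1 / C) ^ 6) ^ m * K := by positivity
    have e : 6 * (m + 1) + i = 6 * m + (6 + i) := by ring
    rw [e, pow_succ, abs_le]
    have up := rec_step A B C hA hAB hBC _ hK' (fun n => q (6 * m + n))
      (fun n => hq (6 * m + n))
      (abs_le.1 (ih 0 (by norm_num))).2 (abs_le.1 (ih 1 (by norm_num))).2
      (abs_le.1 (ih 2 (by norm_num))).2 (abs_le.1 (ih 3 (by norm_num))).2 i hi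
    have lo := rec_step A B C hA hAB hBC _ hK' (fun n => - q (6 * m + n))
      (fun n => by
        have h := hq (6 * m + n)
        simp only [add_assoc] at h ⊢
        linarith)
      (neg_le.1 (abs_le.1 (ih 0 (by norm_num))).1) (neg_le.1 (abs_le.1 (ih 1 (by norm_num))).1)
      (neg_le.1 (abs_le.1 (ih 2 (by norm_num))).1) (neg_le.1 (abs_le.1 (ih 3 (by norm_num))).1) i hi
    constructor <;> linarith

/-- The inverse of `M` on vectors. -/
noncomputable def gInv (A B C : ℝ) (v : Fin 3 → ℝ) : Fin 3 → ℝ :=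
  ![v 1 - B * (v 0 / C), v 2 - A * (v 0 / C), - (v 0 / C)]

lemma gInv_mul (A B C : ℤ) (hC : (C : ℝ) ≠ 0) (v : Fin 3 → ℝ) :
    gInv A B C ((Mmat A B C).mulVec v) = v := by
  ext i
  fin_cases i <;>
    simp [gInv, Mmat, Matrix.mulVec, dotProduct, Fin.sum_univ_three] <;> field_simp <;> ring

/-- Uniform decay of the iterates of the inverse. -/
lemma gInv_decay (A B C : ℝ) (hA : 1 ≤ A) (hAB : A ≤ B) (hBC : B + 1 ≤ C) (K : ℝ) (hK : 0 ≤ K)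
    (ε : ℝ) (hε : 0 < ε) :
    ∃ n : ℕ, ∀ v : Fin 3 → ℝ, (∀ i, |v i| ≤ K) → ∀ i, |((gInv A B C)^[n] v) i| ≤ ε := by
  have hC : 0 < C := by linarith
  have hC1 : C ≠ 0 := hC.ne'
  have hr0 : 0 < 1 / C := by positivity
  have hr1 : 1 / C ≤ 1 := by rw [div_le_one hC]; linarith
  have hl : 0 ≤ 1 - (1 / C) ^ 6 := by
    have := pow_le_one₀ (n := 6) hr0.le hr1
    linarith
  have hl1 : 1 - (1 / C) ^ 6 < 1 := by
    have : 0 < (1 / C) ^ 6 := by positivity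
    linarith
  set K' := (1 + A + B + C) * K * 1 with hK'
  -- bound on the first four third coordinates
  have lim : Filter.Tendsto (fun m : ℕ => (1 - (1 / C) ^ 6) ^ m * ((1 + A + B + C) * (4 * C * K)))
      Filter.atTop (nhds 0) := by
    simpa using (tendsto_pow_atTop_nhds_zero_of_lt_one hl hl1).mul_const
      ((1 + A + B + C) * (4 * C * K))
  obtain ⟨m, hm⟩ := (lim.eventually (gt_mem_nhds hε)).exists
  refine ⟨6 * m, fun v hv => ?_⟩
  set w : ℕ → Fin 3 → ℝ := fun n => (gInv A B C)^[n] v with hw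
  have hs : ∀ n, w (n+1) = gInv A B C (w n) := fun n => by
    simp only [hw, Function.iterate_succ_apply']
  have x0 : ∀ n, w n 0 = - C * w (n+1) 2 := fun n => by rw [hs]; simp [gInv]; field_simp
  have x1 : ∀ n, w n 1 = w (n+1) 0 - B * w (n+1) 2 := fun n => by rw [hs]; simp [gInv]
  have x2 : ∀ n, w n 2 = w (n+1) 1 - A * w (n+1) 2 := fun n => by rw [hs]; simp [gInv]
  have y1 : ∀ n, w n 1 = - C * w (n+2) 2 - B * w (n+1) 2 := fun n => by rw [x1, x0 (n+1)]
  have hrec : ∀ n, w n 2 + A * w (n+1) 2 + B * w (n+2) 2 + C * w (n+3) 2 = 0 := fun n => by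
    have := x2 n
    have := y1 (n+1)
    have e : n + 1 + 2 = n + 3 := rfl
    have e' : n + 1 + 1 = n + 2 := rfl
    simp only [e, e'] at this
    linarith
  have b0 := hv 0
  have b1 := hv 1
  have b2 := hv 2
  have hK4 : K ≤ 4 * C * K := by nlinarith
  have CK : K ≤ C * K := by nlinarith
  have bd : ∀ i < 4, |w i 2| ≤ 4 * C * K := by
    have z0 : w 0 = v := rfl
    have q0 : |w 0 2| ≤ K := by rw [z0]; exact b2
    have q1 : |w 1 2| ≤ K := by
      have h := x0 0
      rw [z0] at h
      rw [h] at b0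
      rw [abs_mul, abs_neg, abs_of_pos hC] at b0
      have : 0 ≤ |w 1 2| := abs_nonneg _
      simp only [zero_add] at *
      nlinarith
    have q2 : |w 2 2| ≤ 2 * K := by
      have h := y1 0
      rw [z0] at h
      simp only [zero_add] at h
      rw [abs_le] at *
      have h1 : B * w 1 2 ≤ B * K := mul_le_mul_of_nonneg_left q1.2 (by linarith)
      have h2 : B * (-K) ≤ B * w 1 2 := mul_le_mul_of_nonneg_left q1.1 (by linarith)
      have h3 : B * K ≤ C * K := mul_le_mul_of_nonneg_right (by linarith) hK
      constructor <;> refine le_of_mul_le_mul_left ?_ hC <;> linarith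
    have q3 : |w 3 2| ≤ 4 * K := by
      have h := hrec 0
      simp only [zero_add] at h
      rw [abs_le] at *
      have h1 : B * w 2 2 ≤ B * (2 * K) := mul_le_mul_of_nonneg_left q2.2 (by linarith)
      have h2 : B * (-(2 * K)) ≤ B * w 2 2 := mul_le_mul_of_nonneg_left q2.1 (by linarith)
      have h3 : B * K ≤ C * K := mul_le_mul_of_nonneg_right (by linarith) hK
      have h4 : A * w 1 2 ≤ A * K := mul_le_mul_of_nonneg_left q1.2 (by linarith)
      have h5 : A * (-K) ≤ A * w 1 2 := mul_le_mul_of_nonneg_left q1.1 (by linarith)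
      have h6 : A * K ≤ C * K := mul_le_mul_of_nonneg_right (by linarith) hK
      constructor <;> refine le_of_mul_le_mul_left ?_ hC <;> linarith
    intro i hi
    interval_cases i <;> nlinarith
  have dec := rec_abs A B C hA hAB hBC (4 * C * K) (by positivity) (fun n => w n 2) hrec bd m
  have hm' : (1 + A + B + C) * ((1 - (1 / C) ^ 6) ^ m * (4 * C * K)) ≤ ε := by
    have := hm.le
    linarith
  set L := (1 - (1 / C) ^ 6) ^ m * (4 * C * K) with hL
  have hL0 : 0 ≤ L := by positivity
  have d0 := dec 0 (by norm_num)
  have d1 := dec 1 (by norm_num)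
  have d2 := dec 2 (by norm_num)
  simp only [add_zero] at d0
  have AL : 0 ≤ A * L := by positivity
  have BL : 0 ≤ B * L := mul_nonneg (by linarith) hL0
  have CL : 0 ≤ C * L := by positivity
  have c1 : |C * w (6*m+1) 2| ≤ C * L := by
    rw [abs_mul, abs_of_pos hC]; exact mul_le_mul_of_nonneg_left d1 hC.le
  have c2 : |C * w (6*m+2) 2| ≤ C * L := by
    rw [abs_mul, abs_of_pos hC]; exact mul_le_mul_of_nonneg_left d2 hC.le
  have c3 : |B * w (6*m+1) 2| ≤ B * L := by
    rw [abs_mul, abs_of_pos (by linarith : 0 < B)]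
    exact mul_le_mul_of_nonneg_left d1 (by linarith)
  have e0 := x0 (6*m)
  have e1 := y1 (6*m)
  intro i
  change |w (6*m) i| ≤ ε
  fin_cases i
  · change |w (6*m) 0| ≤ ε
    rw [abs_le] at *
    constructor <;> linarith
  · change |w (6*m) 1| ≤ ε
    rw [abs_le] at *
    constructor <;> linarith
  · change |w (6*m) 2| ≤ ε
    linarith

/-- The fourteen neighbors in coordinates with respect to the basis P, Q, N. -/
def G14 : Finset (ℤ × ℤ × ℤ) :=
  {(1,0,0), (0,1,0), (0,0,1), (-1,1,0), (0,-1,1), (-1,0,1), (1,-1,1),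
   (-1,0,0), (0,-1,0), (0,0,-1), (1,-1,0), (0,1,-1), (1,0,-1), (-1,1,-1)}

def emb (A B : ℤ) (t : ℤ × ℤ × ℤ) : Fin 3 → ℤ :=
  ![t.1 + A * t.2.1 + B * t.2.2, t.2.1 + A * t.2.2, t.2.2]

lemma emb_inj (A B : ℤ) : Function.Injective (emb A B) := by
  rintro ⟨p, q, n⟩ ⟨p', q', n'⟩ h
  have h0 := congrFun h 0
  have h1 := congrFun h 1
  have h2 := congrFun h 2
  simp [emb] at h0 h1 h2
  subst h2
  have : q = q' := by linarith
  subst this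
  have : p = p' := by linarith
  subst this
  rfl

lemma G14_step (A B C : ℤ) (hA : 1 ≤ A) (hAB : A ≤ B) (hBC : B < C) (t : ℤ × ℤ × ℤ)
    (ht : t ∈ G14) : ∃ p' : ℤ, (p', t.1, t.2.1) ∈ G14 ∧
      -(C - 1) ≤ p' + A * t.1 + B * t.2.1 + C * t.2.2 ∧
      p' + A * t.1 + B * t.2.1 + C * t.2.2 ≤ C - 1 := by
  simp only [G14, Finset.mem_insert, Finset.mem_singleton] at ht
  rcases ht with h | h | h | h | h | h | h | h | h | h | h | h | h | h <;> subst h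
  · exact ⟨0, by decide, by simp <;> omega, by simp <;> omega⟩
  · exact ⟨0, by decide, by simp <;> omega, by simp <;> omega⟩
  · exact ⟨-1, by decide, by simp <;> omega, by simp <;> omega⟩
  · exact ⟨0, by decide, by simp <;> omega, by simp <;> omega⟩
  · exact ⟨0, by decide, by simp <;> omega, by simp <;> omega⟩
  · exact ⟨0, by decide, by simp <;> omega, by simp <;> omega⟩
  · exact ⟨-1, by decide, by simp <;> omega, by simp <;> omega⟩
  · exact ⟨0, by decide, by simp <;> omega, by simp <;> omega⟩
  · exact ⟨0, by decide, by simp <;> omega, by simp <;> omega⟩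
  · exact ⟨1, by decide, by simp <;> omega, by simp <;> omega⟩
  · exact ⟨0, by decide, by simp <;> omega, by simp <;> omega⟩
  · exact ⟨0, by decide, by simp <;> omega, by simp <;> omega⟩
  · exact ⟨0, by decide, by simp <;> omega, by simp <;> omega⟩
  · exact ⟨1, by decide, by simp <;> omega, by simp <;> omega⟩

lemma digit_pre {A B C : ℤ} {T : Set (Fin 3 → ℝ)} (hT : IsABCTile A B C T) (x : Fin 3 → ℝ)
    (hx : x ∈ T) (d : ℤ) (h0 : 0 ≤ d) (h1 : d < C) :
    ∃ u ∈ T, (Mmat A B C).mulVec u = x + ![(d : ℝ), 0, 0] := by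
  obtain ⟨_, _, _, _, _, _, h⟩ := hT
  have : x + ![(d : ℝ), 0, 0] ∈ (Mmat A B C).mulVec '' T := by
    rw [h]
    refine Set.mem_biUnion (x := ![(d : ℝ), 0, 0]) ⟨d, h0, h1, rfl⟩ ?_
    exact ⟨x, hx, rfl⟩
  exact this

lemma walk {A B C : ℤ} {T : Set (Fin 3 → ℝ)} (hT : IsABCTile A B C T) (K : ℝ)
    (hK : ∀ t ∈ G14, ∀ x ∈ T, ∀ y ∈ T, ∀ i, |(y + toR (emb A B t) - x) i| ≤ K) (n : ℕ) :
    ∀ t ∈ G14, ∃ v : Fin 3 → ℝ, (∀ i, |v i| ≤ K) ∧ ∃ x ∈ T, ∃ y ∈ T,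
      (gInv A B C)^[n] v = y + toR (emb A B t) - x := by
  have hT' := hT
  obtain ⟨hA, hAB, hBC, ⟨x0, hx0⟩, _, _, _⟩ := hT'
  have hC : (C : ℝ) ≠ 0 := by
    have : C ≠ 0 := by omega
    exact_mod_cast this
  induction n with
  | zero =>
    intro t ht
    exact ⟨_, hK t ht x0 hx0 x0 hx0, x0, hx0, x0, hx0, rfl⟩
  | succ n ih =>
    rintro ⟨p, q, r⟩ ht
    obtain ⟨p', hp', hk1, hk2⟩ := G14_step A B C hA hAB hBC _ ht
    simp only at hp' hk1 hk2
    obtain ⟨v, hv, x, hx, y, hy, hxy⟩ := ih _ hp'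
    set k := p' + A * p + B * q + C * r with hk
    obtain ⟨u, hu, hu'⟩ := digit_pre hT x hx (max 0 (-k)) (by omega) (by omega)
    obtain ⟨w, hw, hw'⟩ := digit_pre hT y hy (max 0 k) (by omega) (by omega)
    refine ⟨v, hv, u, hu, w, hw, ?_⟩
    rw [Function.iterate_succ_apply', hxy, ← gInv_mul A B C hC (w + toR (emb A B (p, q, r)) - u)]
    congr 1
    rw [Matrix.mulVec_sub, Matrix.mulVec_add, hu', hw']
    have hkk : ((max 0 k : ℤ) : ℝ) - ((max 0 (-k) : ℤ) : ℝ) = p' + A * p + B * q + C * r := by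
      have : max 0 k - max 0 (-k) = k := by omega
      rw [← Int.cast_sub, this, hk]
      push_cast
      ring
    ext i
    fin_cases i
    · simp [toR, emb, Mmat, Matrix.mulVec, dotProduct, Fin.sum_univ_three, Matrix.vecHead, Matrix.vecTail] at hkk ⊢
      linarith
    · simp [toR, emb, Mmat, dotProduct, Fin.sum_univ_three, Matrix.vecHead, Matrix.vecTail]
    · simp [toR, emb, Mmat, dotProduct, Fin.sum_univ_three, Matrix.vecHead, Matrix.vecTail]

lemma G14_sub {A B C : ℤ} {T : Set (Fin 3 → ℝ)} (hT : IsABCTile A B C T) (t : ℤ × ℤ × ℤ)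
    (ht : t ∈ G14) : emb A B t ∈ Neighbors T := by
  have hT' := hT
  obtain ⟨hA, hAB, hBC, hne, hcomp, _, _⟩ := hT'
  have hAr : (1 : ℝ) ≤ A := by exact_mod_cast hA
  have hABr : (A : ℝ) ≤ B := by exact_mod_cast hAB
  have hBCr : (B : ℝ) + 1 ≤ C := by exact_mod_cast hBC
  refine ⟨?_, ?_⟩
  · intro h
    have h0 : emb A B (0, 0, 0) = 0 := by
      ext i; fin_cases i <;> simp [emb]
    have := emb_inj A B (h.trans h0.symm)
    subst this
    revert ht
    decide
  -- uniform bound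
  obtain ⟨R, hR⟩ := hcomp.isBounded.exists_norm_le
  obtain ⟨R', hR'⟩ : ∃ R' : ℝ, ∀ t ∈ G14, ‖toR (emb A B t)‖ ≤ R' := by
    refine ⟨∑ t ∈ G14, ‖toR (emb A B t)‖, fun t ht => ?_⟩
    exact Finset.single_le_sum (f := fun t => ‖toR (emb A B t)‖) (fun _ _ => norm_nonneg _) ht
  have hK : ∀ t ∈ G14, ∀ x ∈ T, ∀ y ∈ T, ∀ i, |(y + toR (emb A B t) - x) i| ≤ R + R' + R := by
    intro t ht x hx y hy i
    have h1 : |(y + toR (emb A B t) - x) i| ≤ ‖y + toR (emb A B t) - x‖ :=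
      norm_le_pi_norm (y + toR (emb A B t) - x) i
    have h2 := norm_sub_le (y + toR (emb A B t)) x
    have h3 := norm_add_le y (toR (emb A B t))
    have := hR x hx
    have := hR y hy
    have := hR' t ht
    linarith
  have hK0 : 0 ≤ R + R' + R := by
    obtain ⟨x, hx⟩ := hne
    exact (abs_nonneg _).trans (hK t ht x hx x hx 0)
  by_contra hcon
  have hdisj : Disjoint T (tileTranslate (toR (emb A B t)) T) := by
    rw [Set.disjoint_iff_inter_eq_empty]
    exact Set.not_nonempty_iff_eq_empty.1 hcon
  have hcomp2 : IsCompact (tileTranslate (toR (emb A B t)) T) :=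
    hcomp.image (by fun_prop)
  obtain ⟨δ, hδ, hsep⟩ := Metric.exists_pos_forall_lt_edist hcomp hcomp2.isClosed hdisj
  obtain ⟨n, hn⟩ := gInv_decay A B C hAr hABr hBCr _ hK0 (δ : ℝ) (by exact_mod_cast hδ)
  obtain ⟨v, hv, x, hx, y, hy, hxy⟩ := walk hT _ hK n t ht
  have h1 := hn v hv
  have h2 := hsep x hx (y + toR (emb A B t)) ⟨y, hy, rfl⟩
  rw [hxy] at h1
  have h3 : ‖y + toR (emb A B t) - x‖ ≤ δ := (pi_norm_le_iff_of_nonneg δ.2).2 h1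
  rw [← dist_eq_norm, dist_comm] at h3
  rw [edist_nndist, ENNReal.coe_lt_coe] at h2
  have h4 : (δ : ℝ) < dist x (y + toR (emb A B t)) := by
    rw [← coe_nndist]; exact_mod_cast h2
  linarith

lemma neighbors_eq {A B C : ℤ} {T : Set (Fin 3 → ℝ)} (hT : IsABCTile A B C T)
    (h14 : (Neighbors T).ncard = 14) : Neighbors T = ((G14.image (emb A B) : Finset _) : Set _) := by
  symm
  apply Set.eq_of_subset_of_ncard_le
  · intro α hα
    simp only [Finset.coe_image, Set.mem_image] at hα
    obtain ⟨t, ht, rfl⟩ := hα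
    exact G14_sub hT t ht
  · rw [h14, Set.ncard_coe_finset, Finset.card_image_of_injective _ (emb_inj A B)]
    decide
  · exact Set.finite_of_ncard_ne_zero (by omega)

/-- The height functional sending P, Q, N to 1, 2, 3. -/
def ht3 (A B : ℤ) (α : Fin 3 → ℤ) : ℤ :=
  (α 0 - A * (α 1 - A * α 2) - B * α 2) + 2 * (α 1 - A * α 2) + 3 * α 2

lemma ht3_bound {A B C : ℤ} {T : Set (Fin 3 → ℝ)} (hT : IsABCTile A B C T)
    (h14 : (Neighbors T).ncard = 14) (α : Fin 3 → ℤ) (hα : α ∈ Neighbors T) :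
    ht3 A B α ≠ 0 ∧ -3 ≤ ht3 A B α ∧ ht3 A B α ≤ 3 := by
  rw [neighbors_eq hT h14] at hα
  simp only [Finset.coe_image, Set.mem_image, Finset.mem_coe] at hα
  obtain ⟨t, ht, rfl⟩ := hα
  have e : ht3 A B (emb A B t) = t.1 + 2 * t.2.1 + 3 * t.2.2 := by
    simp [ht3, emb]
    ring
  rw [e]
  clear e
  revert t
  decide

lemma pair_bound {A B C : ℤ} {T : Set (Fin 3 → ℝ)} (hT : IsABCTile A B C T)
    (h14 : (Neighbors T).ncard = 14) (α β : Fin 3 → ℤ) (hne : α ≠ β) (x : Fin 3 → ℝ)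
    (hx : x ∈ tileTranslate (toR α) T) (hy : x ∈ tileTranslate (toR β) T) :
    ht3 A B α ≠ ht3 A B β ∧ -3 ≤ ht3 A B α - ht3 A B β ∧ ht3 A B α - ht3 A B β ≤ 3 := by
  obtain ⟨s, hs, hs'⟩ := hx
  obtain ⟨u, hu, hu'⟩ := hy
  have hmem : α - β ∈ Neighbors T := by
    refine ⟨sub_ne_zero.2 hne, u, hu, s, hs, ?_⟩
    ext i
    have h1 := congrFun hs' i
    have h2 := congrFun hu' i
    simp [toR] at h1 h2 ⊢
    linarith
  have := ht3_bound hT h14 _ hmem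
  have e : ht3 A B (α - β) = ht3 A B α - ht3 A B β := by
    simp [ht3]; ring
  rw [e] at this
  omega

lemma five_empty {A B C : ℤ} {T : Set (Fin 3 → ℝ)} (hT : IsABCTile A B C T)
    (h14 : (Neighbors T).ncard = 14) (x : Fin 3 → ℝ) (a : Fin 5 → Fin 3 → ℤ)
    (ha : Function.Injective a) (hx : ∀ i, x ∈ tileTranslate (toR (a i)) T) : False := by
  have key : ∀ i j, i ≠ j → ht3 A B (a i) ≠ ht3 A B (a j) ∧
      -3 ≤ ht3 A B (a i) - ht3 A B (a j) ∧ ht3 A B (a i) - ht3 A B (a j) ≤ 3 :=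
    fun i j hij => pair_bound hT h14 _ _ (fun h => hij (ha h)) x (hx i) (hx j)
  have k01 := key 0 1 (by decide)
  have k02 := key 0 2 (by decide)
  have k03 := key 0 3 (by decide)
  have k04 := key 0 4 (by decide)
  have k12 := key 1 2 (by decide)
  have k13 := key 1 3 (by decide)
  have k14 := key 1 4 (by decide)
  have k23 := key 2 3 (by decide)
  have k24 := key 2 4 (by decide)
  have k34 := key 3 4 (by decide)
  omega

lemma mem_translate_zero {T : Set (Fin 3 → ℝ)} {x : Fin 3 → ℝ} (hx : x ∈ T) :
    x ∈ tileTranslate (toR 0) T := ⟨x, hx, by ext i; simp [toR]⟩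

lemma five_empty' {A B C : ℤ} {T : Set (Fin 3 → ℝ)} (hT : IsABCTile A B C T)
    (h14 : (Neighbors T).ncard = 14) : ∀ α₁ α₂ α₃ α₄ : Fin 3 → ℤ,
      α₁ ≠ 0 → α₂ ≠ 0 → α₃ ≠ 0 → α₄ ≠ 0 →
      α₁ ≠ α₂ → α₁ ≠ α₃ → α₁ ≠ α₄ → α₂ ≠ α₃ → α₂ ≠ α₄ → α₃ ≠ α₄ →
      T ∩ tileTranslate (toR α₁) T ∩ tileTranslate (toR α₂) T ∩ tileTranslate (toR α₃) T ∩
        tileTranslate (toR α₄) T = ∅ := by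
  intro a b c d ha hb hc hd hab hac had hbc hbd hcd
  rw [Set.eq_empty_iff_forall_notMem]
  rintro x ⟨⟨⟨⟨h0, h1⟩, h2⟩, h3⟩, h4⟩
  refine five_empty hT h14 x ![0, a, b, c, d] ?_ ?_
  · intro i j hij
    fin_cases i <;> fin_cases j <;> simp_all [eq_comm]
  · intro i
    fin_cases i
    · exact mem_translate_zero h0
    · exact h1
    · exact h2
    · exact h3
    · exact h4

theorem stmt8 (A B C : ℤ) (T : Set (Fin 3 → ℝ)) (hT : IsABCTile A B C T)
    (h14 : (Neighbors T).ncard = 14) :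
    (∀ α₁ α₂ α₃ α₄ : Fin 3 → ℤ, α₁ ≠ 0 → α₂ ≠ 0 → α₃ ≠ 0 → α₄ ≠ 0 →
      α₁ ≠ α₂ → α₁ ≠ α₃ → α₁ ≠ α₄ → α₂ ≠ α₃ → α₂ ≠ α₄ → α₃ ≠ α₄ →
      T ∩ tileTranslate (toR α₁) T ∩ tileTranslate (toR α₂) T ∩ tileTranslate (toR α₃) T ∩
        tileTranslate (toR α₄) T = ∅) ∧
    (∀ ℓ : ℕ, 4 ≤ ℓ → ∀ a : Fin ℓ → Fin 3 → ℤ, Function.Injective a → (∀ i, a i ≠ 0) →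
      T ∩ ⋂ i : Fin ℓ, tileTranslate (toR (a i)) T = ∅) := by
  refine ⟨five_empty' hT h14, ?_⟩
  intro l hl a ha h0
  rw [Set.eq_empty_iff_forall_notMem]
  rintro x ⟨hx, hx'⟩
  rw [Set.mem_iInter] at hx'
  have ne : ∀ i j : Fin l, i ≠ j → a i ≠ a j := fun i j hij h => hij (ha h)
  have key := five_empty' hT h14 (a ⟨0, by omega⟩) (a ⟨1, by omega⟩) (a ⟨2, by omega⟩)
    (a ⟨3, by omega⟩) (h0 _) (h0 _) (h0 _) (h0 _)
    (ne _ _ (by simp)) (ne _ _ (by simp)) (ne _ _ (by simp)) (ne _ _ (by simp))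
    (ne _ _ (by simp)) (ne _ _ (by simp))
  have hmem : x ∈ (∅ : Set (Fin 3 → ℝ)) := by
    rw [← key]
    exact ⟨⟨⟨⟨hx, hx' _⟩, hx' _⟩, hx' _⟩, hx' _⟩
  exact hmem
end

section
/- Let T be an ABC-tile, let α₀ ∈ ℤ³ \ {0}, and let x ∈ ℝ³. Then x ∈ T ∩ (T + α₀) if and only if there exist sequences d, e : ℕ → D and a : ℕ → ℤ³ such that a(0) = α₀, a(n) is a neighbor of T for every n, a(n+1) = M·a(n) + e(n) − d(n) for every n ≥ 0, and x = Σ_{n=0}^∞ M^{−(n+1)} d(n). -/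
open MeasureTheory

open Filter Topology

noncomputable def Ninv (A B C : ℤ) : Matrix (Fin 3) (Fin 3) ℝ :=
  !![-(B : ℝ) / C, 1, 0; -(A : ℝ) / C, 0, 1; -1 / (C : ℝ), 0, 0]

lemma Ninv_mul (A B C : ℤ) (hC : (C : ℝ) ≠ 0) : Ninv A B C * Mmat A B C = 1 := by
  ext i j
  fin_cases i <;> fin_cases j <;>
    simp [Ninv, Mmat, Matrix.mul_apply, Fin.sum_univ_three] <;> field_simp <;> ring

lemma Mmat_inv (A B C : ℤ) (hC : (C : ℝ) ≠ 0) : (Mmat A B C)⁻¹ = Ninv A B C :=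
  Matrix.inv_eq_left_inv (Ninv_mul A B C hC)

lemma root_bound (A B C : ℝ) (hA : 1 ≤ A) (hAB : A ≤ B) (hBC : B < C) (z : ℂ)
    (hz : C * z ^ 3 + B * z ^ 2 + A * z + 1 = 0) : ‖z‖ < 1 := by
  by_contra hcon
  push Not at hcon
  have hz0 : z ≠ 0 := by
    rintro rfl
    simp at hz
  have key : (C * z - (C - B : ℝ)) * z ^ 3 = (B - A : ℝ) * z ^ 2 + (A - 1 : ℝ) * z + 1 := by
    push_cast
    linear_combination (z - 1) * hz
  have hr0 : 0 < ‖z‖ := by linarith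
  set r := ‖z‖ with hr
  have h1 : ‖(C * z - (C - B : ℝ))‖ * r ^ 3 ≤ B * r ^ 3 := by
    have : ‖(C * z - (C - B : ℝ))‖ * r ^ 3 = ‖((B - A : ℝ) * z ^ 2 + (A - 1 : ℝ) * z + 1 : ℂ)‖ := by
      rw [← key, norm_mul, norm_pow]
    rw [this]
    have e1 : ‖((B - A : ℝ) * z ^ 2 : ℂ)‖ = (B - A) * r ^ 2 := by
      rw [norm_mul, norm_pow, Complex.norm_real, Real.norm_of_nonneg (by linarith)]
    have e2 : ‖((A - 1 : ℝ) * z : ℂ)‖ = (A - 1) * r := by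
      rw [norm_mul, Complex.norm_real, Real.norm_of_nonneg (by linarith)]
    have e3 := norm_add₃_le (a := ((B - A : ℝ) * z ^ 2 : ℂ)) (b := ((A - 1 : ℝ) * z : ℂ)) (c := 1)
    rw [e1, e2, norm_one] at e3
    have p2 : r ^ 2 ≤ r ^ 3 := pow_le_pow_right₀ hcon (by norm_num)
    have p1 : r ≤ r ^ 3 := le_self_pow₀ hcon (by norm_num)
    have p0 : 1 ≤ r ^ 3 := one_le_pow₀ hcon
    have q2 := mul_le_mul_of_nonneg_left p2 (by linarith : 0 ≤ B - A)
    have q1 := mul_le_mul_of_nonneg_left p1 (by linarith : 0 ≤ A - 1)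
    nlinarith
  have h2 : ‖(C * z - (C - B : ℝ))‖ ≤ B := le_of_mul_le_mul_right h1 (by positivity)
  have h3 : ‖(C * z - (C - B : ℝ))‖ ^ 2 ≤ B ^ 2 := by gcongr
  rw [← Complex.normSq_eq_norm_sq, Complex.normSq_apply] at h3
  simp at h3
  have h4 : r ^ 2 = z.re * z.re + z.im * z.im := by
    rw [hr, ← Complex.normSq_eq_norm_sq, Complex.normSq_apply]
  have h5 : z.re ≤ r := (le_abs_self _).trans (Complex.abs_re_le_norm z)
  have hC : 0 < C := by linarith
  have h6 : (C * r - (C - B)) ^ 2 ≤ B ^ 2 := by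
    have := mul_le_mul_of_nonneg_left h5 (by nlinarith : 0 ≤ C * (C - B))
    have e : (C * r - (C - B)) ^ 2 = C ^ 2 * r ^ 2 - 2 * (C * (C - B) * r) + (C - B) ^ 2 := by ring
    rw [e, h4]
    linarith
  have h7 : C * r - (C - B) ≤ B := (le_abs_self _).trans (abs_le_of_sq_le_sq h6 (by linarith))
  have h8 : r = 1 := by
    apply le_antisymm _ hcon
    have : C * r ≤ C * 1 := by linarith
    exact le_of_mul_le_mul_left this hC
  rw [h8] at h4 h5
  have h9 : 1 ≤ z.re := by
    have : 0 < C * (C - B) := by apply mul_pos hC; linarith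
    have : (C * (C - B)) * 1 ≤ (C * (C - B)) * z.re := by
      have e : C ^ 2 * (z.re * z.re + z.im * z.im) = C ^ 2 := by rw [← h4]; ring
      linarith
    exact le_of_mul_le_mul_left this ‹_›
  have h10 : z.re = 1 := le_antisymm h5 h9
  have h11 : z.im = 0 := by
    rw [h10] at h4
    have : z.im * z.im = 0 := by linarith
    simpa using this
  have hz1 : z = 1 := Complex.ext (by simpa using h10) (by simpa using h11)
  subst hz1
  have := congrArg Complex.re hz
  simp at this
  linarith

section
attribute [local instance] Matrix.linftyOpNormedRing Matrix.linftyOpNormedAlgebra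

lemma summable_Ninv (A B C : ℤ) (hA : 1 ≤ A) (hAB : A ≤ B) (hBC : B < C) :
    Summable (fun n : ℕ => ‖Ninv A B C ^ n‖) := by
  let f : ℝ →+* ℂ := Complex.ofRealHom
  let N : Matrix (Fin 3) (Fin 3) ℂ := f.mapMatrix (Ninv A B C)
  have hnorm : ∀ n : ℕ, ‖Ninv A B C ^ n‖ = ‖N ^ n‖ := by
    intro n
    have : N ^ n = f.mapMatrix (Ninv A B C ^ n) := (map_pow _ _ _).symm
    rw [this]
    simp only [Matrix.linfty_opNorm_def, RingHom.mapMatrix_apply, Matrix.map_apply]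
    simp [f]
  have hC : (C : ℝ) ≠ 0 := by
    have : C ≠ 0 := by omega
    exact_mod_cast this
  have hspec : spectralRadius ℂ N < ((1 : NNReal) : ENNReal) := by
    apply spectrum.spectralRadius_lt_of_forall_lt
    intro z hz
    rw [spectrum.mem_iff, Matrix.isUnit_iff_isUnit_det, isUnit_iff_ne_zero, not_not] at hz
    have hCc : (C : ℂ) ≠ 0 := by exact_mod_cast hC
    have : ‖z‖ < 1 := by
      apply root_bound A B C (by exact_mod_cast hA) (by exact_mod_cast hAB) (by exact_mod_cast hBC)
      rw [Matrix.det_fin_three] at hz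
      simp [N, f, Ninv, Matrix.algebraMap_matrix_apply] at hz
      field_simp at hz
      push_cast
      linear_combination hz
    exact_mod_cast this
  have hG := spectrum.pow_nnnorm_pow_one_div_tendsto_nhds_spectralRadius N
  obtain ⟨r, hr1, hr2⟩ := ENNReal.lt_iff_exists_nnreal_btwn.1 hspec
  have hr3 : r < 1 := by exact_mod_cast hr2
  have hev := (hG.eventually (gt_mem_nhds hr1)).and (eventually_gt_atTop 0)
  refine summable_of_isBigO_nat (summable_geometric_of_lt_one r.2 (by exact_mod_cast hr3)) ?_
  apply Asymptotics.IsBigO.of_bound 1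
  filter_upwards [hev] with n hn
  obtain ⟨h1, h2⟩ := hn
  have h3 : (‖N ^ n‖₊ : ENNReal) ≤ (r : ENNReal) ^ n := by
    have hn0 : (n : ℝ) ≠ 0 := by exact_mod_cast h2.ne'
    have := ENNReal.rpow_le_rpow h1.le (Nat.cast_nonneg n : (0 : ℝ) ≤ n)
    rwa [← ENNReal.rpow_mul, one_div_mul_cancel hn0, ENNReal.rpow_one, ENNReal.rpow_natCast] at this
  have h4 : ‖N ^ n‖₊ ≤ r ^ n := by exact_mod_cast h3
  have h5 : ‖N ^ n‖ ≤ (r : ℝ) ^ n := by exact_mod_cast h4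
  rw [hnorm, norm_norm, one_mul]
  exact h5.trans (le_abs_self _)

lemma tend_Ninv (A B C : ℤ) (hA : 1 ≤ A) (hAB : A ≤ B) (hBC : B < C)
    (x : ℕ → Fin 3 → ℝ) (K : ℝ) (hx : ∀ n, ‖x n‖ ≤ K) :
    Tendsto (fun n : ℕ => (Ninv A B C ^ n).mulVec (x n)) atTop (𝓝 0) := by
  have h := (summable_Ninv A B C hA hAB hBC).tendsto_atTop_zero.mul_const K
  rw [zero_mul] at h
  refine squeeze_zero_norm (fun n => ?_) h
  exact (Matrix.linfty_opNorm_mulVec _ _).trans (by gcongr; exact hx n)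

lemma summ_Ninv (A B C : ℤ) (hA : 1 ≤ A) (hAB : A ≤ B) (hBC : B < C)
    (x : ℕ → Fin 3 → ℝ) (K : ℝ) (hx : ∀ n, ‖x n‖ ≤ K) :
    Summable (fun n : ℕ => (Ninv A B C ^ (n + 1)).mulVec (x n)) := by
  have h := ((summable_nat_add_iff 1).2 (summable_Ninv A B C hA hAB hBC)).mul_right K
  refine Summable.of_norm_bounded h (fun n => ?_)
  exact (Matrix.linfty_opNorm_mulVec _ _).trans (by gcongr; exact hx n)

end

lemma cast_ne (A B C : ℤ) (hA : 1 ≤ A) (hAB : A ≤ B) (hBC : B < C) : (C : ℝ) ≠ 0 := by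
  have : C ≠ 0 := by omega
  exact_mod_cast this

lemma hasSum_orbit (A B C : ℤ) (hA : 1 ≤ A) (hAB : A ≤ B) (hBC : B < C)
    (x d : ℕ → Fin 3 → ℝ) (K L : ℝ) (hx : ∀ n, ‖x n‖ ≤ K) (hd : ∀ n, ‖d n‖ ≤ L)
    (h : ∀ n, x (n + 1) = (Mmat A B C).mulVec (x n) - d n) :
    HasSum (fun n : ℕ => (Ninv A B C ^ (n + 1)).mulVec (d n)) (x 0) := by
  have hs := summ_Ninv A B C hA hAB hBC d L hd
  have hC := cast_ne A B C hA hAB hBC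
  have hp : ∀ n, ∑ k ∈ Finset.range n, (Ninv A B C ^ (k + 1)).mulVec (d k)
      = x 0 - (Ninv A B C ^ n).mulVec (x n) := by
    intro n
    induction n with
    | zero => simp
    | succ n ih =>
      rw [Finset.sum_range_succ, ih, h n, Matrix.mulVec_sub, Matrix.mulVec_mulVec]
      have : Ninv A B C ^ (n + 1) * Mmat A B C = Ninv A B C ^ n := by
        rw [pow_succ, mul_assoc, Ninv_mul A B C hC, mul_one]
      rw [this]
      abel
  have ht := hs.hasSum.tendsto_sum_nat
  have ht2 : Tendsto (fun n => x 0 - (Ninv A B C ^ n).mulVec (x n)) atTop (𝓝 (x 0 - 0)) :=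
    tendsto_const_nhds.sub (tend_Ninv A B C hA hAB hBC x K hx)
  rw [sub_zero] at ht2
  have := tendsto_nhds_unique ht (by simpa only [hp] using ht2)
  rw [← this]
  exact hs.hasSum

lemma digit_norm (C : ℤ) (d : Fin 3 → ℝ) (hd : d ∈ Ddig C) : ‖d‖ ≤ |(C : ℝ)| := by
  obtain ⟨i, h0, h1, rfl⟩ := hd
  have a0 : (0 : ℝ) ≤ i := by exact_mod_cast h0
  have a1 : (i : ℝ) ≤ C := by exact_mod_cast h1.le
  rw [pi_norm_le_iff_of_nonneg (abs_nonneg _)]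
  intro j
  fin_cases j <;> simp
  rw [abs_of_nonneg a0]
  exact a1.trans (le_abs_self _)

lemma sum_mem_tile (A B C : ℤ) (T : Set (Fin 3 → ℝ)) (hT : IsABCTile A B C T)
    (d : ℕ → Fin 3 → ℝ) (hd : ∀ n, d n ∈ Ddig C) :
    ∑' n : ℕ, (Ninv A B C ^ (n + 1)).mulVec (d n) ∈ T := by
  obtain ⟨hA, hAB, hBC, ⟨t0, ht0⟩, hc, -, hM⟩ := hT
  have hC := cast_ne A B C hA hAB hBC
  have step : ∀ t ∈ T, ∀ d ∈ Ddig C, (Ninv A B C).mulVec (t + d) ∈ T := by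
    intro t ht d hd
    have : t + d ∈ (Mmat A B C).mulVec '' T := by
      rw [hM]
      exact Set.mem_biUnion hd ⟨t, ht, rfl⟩
    obtain ⟨s, hs, hst⟩ := this
    rw [← hst, Matrix.mulVec_mulVec, Ninv_mul A B C hC, Matrix.one_mulVec]
    exact hs
  have hp : ∀ n, ∀ t ∈ T, (Ninv A B C ^ n).mulVec t
      + ∑ k ∈ Finset.range n, (Ninv A B C ^ (k + 1)).mulVec (d k) ∈ T := by
    intro n
    induction n with
    | zero => intro t ht; simpa using ht
    | succ n ih =>
      intro t ht
      have := ih _ (step t ht (d n) (hd n))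
      rw [Matrix.mulVec_mulVec, ← pow_succ, Matrix.mulVec_add] at this
      rw [Finset.sum_range_succ]
      convert this using 1
      abel
  have hs := summ_Ninv A B C hA hAB hBC d _ (fun n => digit_norm C _ (hd n))
  have ht := (tend_Ninv A B C hA hAB hBC (fun _ => t0) ‖t0‖ (fun _ => le_rfl)).add
    hs.hasSum.tendsto_sum_nat
  rw [zero_add] at ht
  exact hc.isClosed.mem_of_tendsto ht (Eventually.of_forall fun n => hp n t0 ht0)

/-- One step of the walk on the neighbor graph. -/
lemma tile_step (A B C : ℤ) (T : Set (Fin 3 → ℝ)) (hT : IsABCTile A B C T)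
    (x : Fin 3 → ℝ) (α : Fin 3 → ℤ) (hα : α ≠ 0) (hx : x ∈ T) (hy : x - toR α ∈ T) :
    ∃ (d e xn : Fin 3 → ℝ) (β : Fin 3 → ℤ), d ∈ Ddig C ∧ e ∈ Ddig C ∧ β ≠ 0 ∧ xn ∈ T ∧
      xn - toR β ∈ T ∧ xn = (Mmat A B C).mulVec x - d ∧
      toR β = (Mmat A B C).mulVec (toR α) + e - d := by
  obtain ⟨hA, hAB, hBC, -, hc, -, hM⟩ := hT
  have dec : ∀ t ∈ T, ∃ d ∈ Ddig C, (Mmat A B C).mulVec t - d ∈ T := by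
    intro t ht
    have : (Mmat A B C).mulVec t ∈ ⋃ d ∈ Ddig C, tileTranslate d T := by
      rw [← hM]; exact ⟨t, ht, rfl⟩
    simp only [Set.mem_iUnion] at this
    obtain ⟨d, hd, s, hs, hst⟩ := this
    refine ⟨d, hd, ?_⟩
    rw [← hst]
    simpa using hs
  obtain ⟨d, hd, hxd⟩ := dec x hx
  obtain ⟨e, he, hye⟩ := dec _ hy
  obtain ⟨i, hi0, hi1, hdi⟩ := id hd
  obtain ⟨j, hj0, hj1, hej⟩ := id he
  have hβ : toR ![-C * α 2 + j - i, α 0 - B * α 2, α 1 - A * α 2]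
      = (Mmat A B C).mulVec (toR α) + e - d := by
    subst hdi hej
    ext k
    fin_cases k <;> simp [toR, Mmat, Matrix.mulVec, dotProduct, Fin.sum_univ_three] <;> ring
  refine ⟨d, e, _, _, hd, he, ?_, hxd, ?_, rfl, hβ⟩
  · intro h0
    have h1 := congrFun h0 0
    have h2 := congrFun h0 1
    have h3 := congrFun h0 2
    simp at h1 h2 h3
    have h4 : α 2 = 0 := by
      by_contra hne
      rcases lt_or_gt_of_ne hne with h | h
      · nlinarith
      · nlinarith
    rw [h4] at h2 h3
    apply hα
    ext k
    fin_cases k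
    · simpa using h2
    · simpa using h3
    · simpa using h4
  · rw [hβ]
    rw [Matrix.mulVec_sub] at hye
    convert hye using 1
    abel

lemma mem_translate (v x : Fin 3 → ℝ) (T : Set (Fin 3 → ℝ)) :
    x ∈ tileTranslate v T ↔ x - v ∈ T := by
  constructor
  · rintro ⟨y, hy, rfl⟩
    simpa using hy
  · intro h
    exact ⟨_, h, by simp⟩

theorem stmt12 (A B C : ℤ) (T : Set (Fin 3 → ℝ)) (hT : IsABCTile A B C T)
    (α₀ : Fin 3 → ℤ) (hα₀ : α₀ ≠ 0) (x : Fin 3 → ℝ) :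
    x ∈ T ∩ tileTranslate (toR α₀) T ↔
      ∃ (d e : ℕ → Fin 3 → ℝ) (a : ℕ → Fin 3 → ℤ),
        (∀ n, d n ∈ Ddig C) ∧ (∀ n, e n ∈ Ddig C) ∧
        a 0 = α₀ ∧ (∀ n, a n ∈ Neighbors T) ∧
        (∀ n, toR (a (n + 1)) = (Mmat A B C).mulVec (toR (a n)) + e n - d n) ∧
        x = ∑' n : ℕ, ((Mmat A B C)⁻¹ ^ (n + 1)).mulVec (d n) := by
  have hTc := hT
  obtain ⟨hA, hAB, hBC, -, hc, -, -⟩ := hTc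
  have hC := cast_ne A B C hA hAB hBC
  rw [Mmat_inv A B C hC]
  obtain ⟨K, hK⟩ := hc.isBounded.exists_norm_le
  constructor
  · rintro ⟨hx, hy⟩
    rw [mem_translate] at hy
    let S := {p : (Fin 3 → ℝ) × (Fin 3 → ℤ) // p.2 ≠ 0 ∧ p.1 ∈ T ∧ p.1 - toR p.2 ∈ T}
    have hstep : ∀ p : S, ∃ (q : S) (d e : Fin 3 → ℝ), d ∈ Ddig C ∧ e ∈ Ddig C ∧
        q.1.1 = (Mmat A B C).mulVec p.1.1 - d ∧
        toR q.1.2 = (Mmat A B C).mulVec (toR p.1.2) + e - d := by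
      rintro ⟨⟨u, α⟩, h1, h2, h3⟩
      obtain ⟨d, e, xn, β, hd, he, hβ, hxn, hyn, h4, h5⟩ := tile_step A B C T hT u α h1 h2 h3
      exact ⟨⟨(xn, β), hβ, hxn, hyn⟩, d, e, hd, he, h4, h5⟩
    choose f fd fe hfd hfe hf1 hf2 using hstep
    let s : ℕ → S := fun n => f^[n] ⟨(x, α₀), hα₀, hx, hy⟩
    have hs : ∀ n, s (n + 1) = f (s n) := fun n => Function.iterate_succ_apply' f n _
    refine ⟨fun n => fd (s n), fun n => fe (s n), fun n => (s n).1.2, fun n => hfd _,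
      fun n => hfe _, rfl, fun n => ?_, fun n => ?_, ?_⟩
    · exact ⟨(s n).2.1, _, (s n).2.2.1, (mem_translate _ _ _).2 (s n).2.2.2⟩
    · simp only [hs]
      exact hf2 _
    · have := hasSum_orbit A B C hA hAB hBC (fun n => (s n).1.1) (fun n => fd (s n)) K _
        (fun n => hK _ (s n).2.2.1) (fun n => digit_norm C _ (hfd _))
        (fun n => by simp only [hs]; exact hf1 _)
      exact this.tsum_eq.symm
  · rintro ⟨d, e, a, hd, he, ha0, haN, hrec, hxs⟩
    have hab : ∀ n, ‖toR (a n)‖ ≤ K + K := by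
      intro n
      obtain ⟨-, u, hu, hv⟩ := haN n
      rw [mem_translate] at hv
      have : toR (a n) = u - (u - toR (a n)) := by abel
      rw [this]
      exact (norm_sub_le _ _).trans (add_le_add (hK _ hu) (hK _ hv))
    have h1 := hasSum_orbit A B C hA hAB hBC (fun n => toR (a n)) (fun n => d n - e n) _
      (|(C : ℝ)| + |(C : ℝ)|) hab
      (fun n => (norm_sub_le _ _).trans
        (add_le_add (digit_norm C _ (hd n)) (digit_norm C _ (he n))))
      (fun n => by rw [hrec n]; abel)
    have sd := summ_Ninv A B C hA hAB hBC d _ (fun n => digit_norm C _ (hd n))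
    have se := summ_Ninv A B C hA hAB hBC e _ (fun n => digit_norm C _ (he n))
    have h2 := sd.hasSum.sub se.hasSum
    simp only [Matrix.mulVec_sub, ha0] at h1
    have h3 := h1.unique h2
    refine ⟨hxs ▸ sum_mem_tile A B C T hT d hd, ?_⟩
    rw [mem_translate, h3, hxs, sub_sub_cancel]
    exact sum_mem_tile A B C T hT e he
end
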